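/- arXiv:2201.08903 — 10 statements merged into one kernel-verified Lean document; each statement's English description precedes it below -/
import Mathlib

section
/- Let 𝒳 be a separable metric space, 𝒴 a measurable value space and ℓ an unbounded loss function (satisfying ℓ(y,y)=0 and a relaxed triangle inequality with finite constant c_ℓ). Then SUOL = FS: a stochastic process 𝕏 on 𝒳 admits a strongly universally consistent online learning rule if and only if 𝕏 almost surely takes only finitely many distinct values. -/
open MeasureTheory Filter Finset

noncomputable section

/-- An online learning rule: a sequence of measurable functions
`f t : 𝒳^t × 𝒴^t × 𝒳 → 𝒴` mapping the history of the first `t` labeled examples and a new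
input point to a prediction. -/
def IsOnlineLearningRule {𝒳 𝒴 : Type*} [MeasurableSpace 𝒳] [MeasurableSpace 𝒴]
    (f : (t : ℕ) → (Fin t → 𝒳) → (Fin t → 𝒴) → 𝒳 → 𝒴) : Prop :=
  ∀ t : ℕ, Measurable fun p : (Fin t → 𝒳) × (Fin t → 𝒴) × 𝒳 => f t p.1 p.2.1 p.2.2

/-- The average cumulative loss of the learning rule `f` on the process `X` with target `fstar`
after `T` rounds. -/
def avgLoss {𝒳 𝒴 Ω : Type*} (ℓ : 𝒴 → 𝒴 → ℝ)
    (f : (t : ℕ) → (Fin t → 𝒳) → (Fin t → 𝒴) → 𝒳 → 𝒴)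
    (X : ℕ → Ω → 𝒳) (fstar : 𝒳 → 𝒴) (T : ℕ) (ω : Ω) : ℝ :=
  (∑ t ∈ Finset.range T,
      ℓ (f t (fun s : Fin t => X s ω) (fun s : Fin t => fstar (X s ω)) (X t ω))
        (fstar (X t ω))) / (T : ℝ)

/-- Strong universal consistency of the learning rule `f` under the process `X`: for every
measurable target function, the long-run average loss has `limsup` equal to `0` almost surely. -/
def StronglyUniversallyConsistent {𝒳 𝒴 Ω : Type*} [MeasurableSpace 𝒳] [MeasurableSpace 𝒴]
    [MeasurableSpace Ω] (P : Measure Ω) (ℓ : 𝒴 → 𝒴 → ℝ)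
    (f : (t : ℕ) → (Fin t → 𝒳) → (Fin t → 𝒴) → 𝒳 → 𝒴) (X : ℕ → Ω → 𝒳) : Prop :=
  ∀ fstar : 𝒳 → 𝒴, Measurable fstar →
    ∀ᵐ ω ∂P, Filter.limsup (fun T : ℕ => ((avgLoss ℓ f X fstar T ω : ℝ) : EReal)) atTop = 0

/-- Condition FS: the process almost surely takes only finitely many distinct values. -/
def FS {𝒳 Ω : Type*} [MeasurableSpace Ω] (P : Measure Ω) (X : ℕ → Ω → 𝒳) : Prop :=
  ∀ᵐ ω ∂P, (Set.range fun t => X t ω).Finite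

theorem aux_card_avoid {C : Type*} [Fintype C] [DecidableEq C] (M : ℕ) (D : Finset C) :
    (univ.filter fun h : C → Fin (M + 1) => ∀ d ∈ D, h d ≠ 0).card * (M + 1) ^ D.card
      = M ^ D.card * (M + 1) ^ Fintype.card C := by
  have h1 : (univ.filter fun h : C → Fin (M + 1) => ∀ d ∈ D, h d ≠ 0)
      = Fintype.piFinset (fun c => if c ∈ D then (univ.erase (0 : Fin (M+1))) else univ) := by
    ext h
    simp only [mem_filter, mem_univ, true_and, Fintype.mem_piFinset]
    refine forall_congr' fun c => ?_
    by_cases hc : c ∈ D <;> simp [hc]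
  rw [h1, Fintype.card_piFinset]
  have h2 : ∀ c, (if c ∈ D then (univ.erase (0 : Fin (M+1))) else univ).card
      = if c ∈ D then M else M + 1 := by
    intro c
    by_cases hc : c ∈ D <;> simp [hc]
  simp only [h2]
  rw [Finset.prod_ite]
  simp only [prod_const]
  have h3 : (univ.filter fun c => c ∈ D) = D := by ext; simp
  have h4 : (univ.filter fun c => c ∉ D) = Dᶜ := by ext; simp
  rw [h3, h4, mul_assoc, ← pow_add, Finset.card_compl_add_card]

theorem aux_card_hit {C : Type*} [Fintype C] [DecidableEq C] (M : ℕ) (c : C) :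
    (univ.filter fun h : C → Fin (M + 1) => h c = 0).card * (M + 1)
      = (M + 1) ^ Fintype.card C := by
  have h1 := aux_card_avoid M ({c} : Finset C)
  have h2 := Finset.card_filter_add_card_filter_not (s := (univ : Finset (C → Fin (M+1))))
    (fun h : C → Fin (M + 1) => h c = 0)
  simp only [mem_singleton, forall_eq, card_singleton, pow_one, ne_eq] at h1
  simp only [card_univ, Fintype.card_fun, Fintype.card_fin] at h2
  have h3 := congrArg (· * (M+1)) h2
  simp only [add_mul] at h3
  rw [h1] at h3
  ring_nf at h3 ⊢
  omega

open Classical in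
/-- The bad event for a colouring. -/
def auxBad {C : Type*} {m : ℕ} (M N k : ℕ) (h : C → Fin (M+1))
    (v : Fin m → C) : Prop :=
  (∃ i : Fin m, (i : ℕ) < k ∧ h (v i) = 0) ∨
    (N ≤ (univ.image v).card ∧ ∀ i, h (v i) ≠ 0)

open Classical in
theorem aux_bad_count {C : Type*} [Fintype C] {m : ℕ} (M N k : ℕ)
    (v : Fin m → C) :
    ((univ.filter fun h : C → Fin (M+1) => auxBad M N k h v).card : ℝ)
      ≤ (k / (M + 1) + (M / (M + 1) : ℝ) ^ N) * (M + 1) ^ Fintype.card C := by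
  have hM : (0:ℝ) < M + 1 := by positivity
  have hsub : (univ.filter fun h : C → Fin (M+1) => auxBad M N k h v) ⊆
      ((univ.filter fun i : Fin m => (i:ℕ) < k).biUnion
        fun i => univ.filter fun h : C → Fin (M + 1) => h (v i) = 0) ∪
      (if N ≤ (univ.image v).card then
        univ.filter fun h : C → Fin (M + 1) => ∀ d ∈ univ.image v, h d ≠ 0 else ∅) := by
    intro h hh
    have hh := (mem_filter.1 hh).2
    rcases hh with ⟨i, hi, hi'⟩ | ⟨h1, h2⟩
    · apply mem_union_left
      simp only [mem_biUnion, mem_filter, mem_univ, true_and]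
      exact ⟨i, hi, hi'⟩
    · apply mem_union_right
      rw [if_pos h1]
      simpa using h2
  have e1 : ∀ c : C, ((univ.filter fun h : C → Fin (M + 1) => h c = 0).card : ℝ)
      = (M + 1 : ℝ) ^ Fintype.card C / (M + 1) := by
    intro c
    rw [eq_div_iff hM.ne']
    exact_mod_cast aux_card_hit M c
  have e2 : (((univ.filter fun i : Fin m => (i:ℕ) < k).biUnion
        fun i => univ.filter fun h : C → Fin (M + 1) => h (v i) = 0).card : ℝ)
        ≤ k * ((M + 1 : ℝ) ^ Fintype.card C / (M + 1)) := by
    calc _ ≤ ((∑ i ∈ (univ.filter fun i : Fin m => (i:ℕ) < k),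
            (univ.filter fun h : C → Fin (M + 1) => h (v i) = 0).card : ℕ) : ℝ) := by
            exact_mod_cast card_biUnion_le
      _ = (univ.filter fun i : Fin m => (i:ℕ) < k).card *
            ((M + 1 : ℝ) ^ Fintype.card C / (M + 1)) := by
            push_cast
            simp only [e1, sum_const, nsmul_eq_mul]
      _ ≤ _ := by
            gcongr
            have : ((univ.filter fun i : Fin m => (i:ℕ) < k).map Fin.valEmbedding) ⊆ range k := by
              intro x hx
              simp only [Finset.mem_map, mem_filter, mem_univ, true_and] at hx
              obtain ⟨i, hi, rfl⟩ := hx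
              simpa using hi
            simpa using card_le_card this
  have e3 : (((if N ≤ (univ.image v).card then
        univ.filter fun h : C → Fin (M + 1) => ∀ d ∈ univ.image v, h d ≠ 0 else ∅).card : ℕ) : ℝ)
        ≤ (M / (M + 1) : ℝ) ^ N * (M + 1) ^ Fintype.card C := by
    split_ifs with hN
    · have h5 : ((univ.filter fun h : C → Fin (M + 1) => ∀ d ∈ univ.image v, h d ≠ 0).card : ℝ)
          = (M / (M + 1) : ℝ) ^ (univ.image v).card * (M + 1) ^ Fintype.card C := by
        rw [div_pow, div_mul_eq_mul_div, eq_div_iff (by positivity)]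
        exact_mod_cast aux_card_avoid M (univ.image v)
      rw [h5]
      gcongr ?_ * _
      apply pow_le_pow_of_le_one (by positivity) _ hN
      rw [div_le_one hM]; linarith
    · simp; positivity
  calc _ ≤ ((_ + _ : ℕ) : ℝ) := by exact_mod_cast (card_le_card hsub).trans (card_union_le _ _)
    _ ≤ _ := by push_cast; exact add_le_add e2 e3
    _ = _ := by field_simp

theorem aux_exists_M_N (k : ℕ) (δ : ℝ) (hδ : 0 < δ) :
    ∃ M N : ℕ, (k / (M + 1) + (M / (M + 1) : ℝ) ^ N) ≤ δ := by
  obtain ⟨M, hM⟩ := exists_nat_gt (k / (δ / 2))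
  have hM0 : (0:ℝ) < M + 1 := by positivity
  have h1 : (k / (M + 1) : ℝ) ≤ δ / 2 := by
    rw [div_lt_iff₀ (by positivity)] at hM
    rw [div_le_iff₀ hM0]
    nlinarith
  obtain ⟨N, hN⟩ := exists_pow_lt_of_lt_one (half_pos hδ)
    (show (M / (M + 1) : ℝ) < 1 by rw [div_lt_one hM0]; linarith)
  exact ⟨M, N, by linarith⟩

/-- Averaging over colourings. -/
theorem aux_avg {Ω : Type*} [MeasurableSpace Ω] (P : Measure Ω) [IsProbabilityMeasure P]
    {C : Type*} [Fintype C] [MeasurableSpace C] [MeasurableSingletonClass C]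
    (m M N k : ℕ) (δ : ℝ)
    (hMN : (k / (M + 1) + (M / (M + 1) : ℝ) ^ N) ≤ δ)
    (V : Ω → Fin m → C) (hV : Measurable V) :
    ∃ h : C → Fin (M+1), P {ω | auxBad M N k h (V ω)} ≤ ENNReal.ofReal δ := by
  classical
  have hmeas : ∀ h : C → Fin (M+1), MeasurableSet {ω | auxBad M N k h (V ω)} := fun h =>
    hV (Set.toFinite {v | auxBad M N k h v}).measurableSet
  have hsum : ∑ h : C → Fin (M+1), P {ω | auxBad M N k h (V ω)}
      ≤ ∑ h : C → Fin (M+1), ENNReal.ofReal δ := by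
    calc _ = ∑ h : C → Fin (M+1), ∫⁻ ω, {ω | auxBad M N k h (V ω)}.indicator 1 ω ∂P := by
            refine sum_congr rfl fun h _ => ?_
            rw [lintegral_indicator_one (hmeas h)]
      _ = ∫⁻ ω, ∑ h : C → Fin (M+1), {ω | auxBad M N k h (V ω)}.indicator 1 ω ∂P := by
            rw [lintegral_finsetSum]
            intro h _
            exact measurable_one.indicator (hmeas h)
      _ ≤ ∫⁻ ω, ∑ h : C → Fin (M+1), ENNReal.ofReal δ ∂P := by
            refine lintegral_mono fun ω => ?_
            have h1 : ∑ h : C → Fin (M+1), {ω | auxBad M N k h (V ω)}.indicator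
                (1 : Ω → ENNReal) ω
                = ((univ.filter fun h : C → Fin (M+1) => auxBad M N k h (V ω)).card : ENNReal) := by
              simp [Set.indicator_apply]
            have h2 := (aux_bad_count M N k (V ω)).trans
              (mul_le_mul_of_nonneg_right hMN (by positivity))
            simp only
            rw [h1, sum_const, card_univ, Fintype.card_fun, Fintype.card_fin, nsmul_eq_mul,
              ← ENNReal.ofReal_natCast, ← ENNReal.ofReal_natCast, ← ENNReal.ofReal_mul (by positivity)]
            apply ENNReal.ofReal_le_ofReal
            push_cast
            rw [mul_comm]
            exact h2
      _ = _ := by simp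
  by_contra! hcon
  exact absurd hsum (not_le.2 (ENNReal.sum_lt_sum_of_nonempty univ_nonempty fun h _ => hcon h))

theorem aux_hit {𝒳 Ω : Type*} [MeasurableSpace 𝒳] [MeasurableSpace.CountablySeparated 𝒳]
    [MeasurableSpace Ω] (P : Measure Ω) [IsProbabilityMeasure P]
    (X : ℕ → Ω → 𝒳) (hX : ∀ t, Measurable (X t)) (a : ENNReal)
    (ha : a < P {ω | ¬ (Set.range fun t => X t ω).Finite}) (k : ℕ) (δ : ENNReal) (hδ : δ ≠ 0) :
    ∃ B : Set 𝒳, MeasurableSet B ∧ ∃ k' > k, P {ω | ∃ s < k, X s ω ∈ B} ≤ δ ∧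
      a ≤ P {ω | ∃ t < k', X t ω ∈ B} + δ := by
  classical
  obtain ⟨g, hg, hginj⟩ := MeasurableSpace.measurable_injection_nat_bool_of_countablySeparated 𝒳
  obtain ⟨r, hr, hrδ⟩ : ∃ r : ℝ, 0 < r ∧ ENNReal.ofReal r ≤ δ := by
    refine ⟨(min δ 1).toReal, ENNReal.toReal_pos ?_ ?_, ?_⟩
    · exact (lt_min (pos_iff_ne_zero.2 hδ) one_pos).ne'
    · exact ne_top_of_le_ne_top ENNReal.one_ne_top (min_le_right _ _)
    · exact ENNReal.ofReal_toReal_le.trans (min_le_left _ _)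
  obtain ⟨M, N, hMN⟩ := aux_exists_M_N k r hr
  let cell : (m : ℕ) → 𝒳 → (Fin m → Bool) := fun m x i => g x i
  have hcell : ∀ m, Measurable (cell m) := fun m =>
    measurable_pi_lambda _ fun i => (measurable_pi_apply _).comp hg
  let V : (m : ℕ) → Ω → Fin m → (Fin m → Bool) := fun m ω t => cell m (X t ω)
  have hV : ∀ m, Measurable (V m) := fun m =>
    measurable_pi_lambda _ fun t => (hcell m).comp (hX t)
  let G : ℕ → Set Ω := fun m => {ω | N ≤ (univ.image (V m ω)).card}
  have hGmono : Monotone G := by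
    intro m m' hm ω hω
    refine le_trans (show N ≤ _ from hω) ?_
    have hsub : univ.image (V m ω) ⊆ (univ.image (V m' ω)).image
        (fun c (i : Fin m) => c (Fin.castLE hm i)) := by
      intro c hc
      simp only [Finset.mem_image, mem_univ, true_and] at hc ⊢
      obtain ⟨t, rfl⟩ := hc
      exact ⟨_, ⟨Fin.castLE hm t, rfl⟩, rfl⟩
    exact (card_le_card hsub).trans card_image_le
  have hGun : {ω | ¬ (Set.range fun t => X t ω).Finite} ⊆ ⋃ m, G m := by
    intro ω hω
    obtain ⟨F, hF, hFc⟩ := Set.Infinite.exists_subset_card_eq (s := Set.range fun t => X t ω) hω N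
    have e1 : ∀ᶠ m in atTop, ∀ x ∈ F, ∃ t < m, X t ω = x := by
      rw [eventually_all_finset]
      intro x hx
      obtain ⟨t, ht⟩ := hF hx
      filter_upwards [eventually_gt_atTop t] with m hm
      exact ⟨t, hm, ht⟩
    have e2 : ∀ᶠ m in atTop, ∀ x ∈ F, ∀ y ∈ F, cell m x = cell m y → x = y := by
      rw [eventually_all_finset]
      intro x hx
      rw [eventually_all_finset]
      intro y hy
      by_cases hxy : x = y
      · exact Eventually.of_forall fun _ _ => hxy
      · have : g x ≠ g y := fun h => hxy (hginj h)
        obtain ⟨i, hi⟩ := Function.ne_iff.1 this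
        filter_upwards [eventually_gt_atTop i] with m hm h
        exact absurd (congrFun h ⟨i, hm⟩) hi
    obtain ⟨m, h1, h2⟩ := (e1.and e2).exists
    refine Set.mem_iUnion.2 ⟨m, ?_⟩
    change N ≤ _
    rw [← hFc, ← card_image_of_injOn (s := F) (f := cell m) (fun x hx y hy h => h2 x hx y hy h)]
    apply card_le_card
    intro c hc
    simp only [Finset.mem_image, mem_univ, true_and] at hc ⊢
    obtain ⟨x, hx, rfl⟩ := hc
    obtain ⟨t, ht, rfl⟩ := h1 x hx
    exact ⟨⟨t, ht⟩, rfl⟩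
  have h1 : a < ⨆ m, P (G m) := by
    rw [← hGmono.measure_iUnion]
    exact ha.trans_le (measure_mono hGun)
  obtain ⟨m0, hm0⟩ := lt_iSup_iff.1 h1
  let m := max m0 (k + 1)
  have hmk : k < m := lt_of_lt_of_le (Nat.lt_succ_self k) (le_max_right _ _)
  have hGm : a ≤ P (G m) := hm0.le.trans (measure_mono (hGmono (le_max_left _ _)))
  obtain ⟨h, hh⟩ := aux_avg P m M N k r hMN (V m) (hV m)
  refine ⟨{x | h (cell m x) = 0}, hcell m (Set.toFinite {c | h c = 0}).measurableSet, m, hmk,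
    ?_, ?_⟩
  · refine le_trans (measure_mono ?_) (hh.trans hrδ)
    rintro ω ⟨s, hs, hs'⟩
    exact Or.inl ⟨⟨s, hs.trans hmk⟩, hs, hs'⟩
  · refine hGm.trans ?_
    refine le_trans (measure_mono (t := {ω | ∃ t < m, X t ω ∈ {x | h (cell m x) = 0}} ∪
      {ω | auxBad M N k h (V m ω)}) ?_) ((measure_union_le _ _).trans ?_)
    · intro ω hω
      by_cases hc : ∃ t < m, X t ω ∈ {x | h (cell m x) = 0}
      · exact Or.inl hc
      · refine Or.inr (Or.inr ⟨?_, fun i hi => hc ⟨i, i.2, hi⟩⟩)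
        convert (show N ≤ _ from hω)
    · gcongr
      exact hh.trans hrδ

theorem aux_J {𝒳 : Type*} [MeasurableSpace 𝒳] (B : ℕ → Set 𝒳) (hB : ∀ j, MeasurableSet (B j)) :
    ∃ J : 𝒳 → ℕ, Measurable J ∧ (∀ x j, x ∈ B j → (∀ i > j, x ∉ B i) → J x = j + 1) ∧
      (∀ x j, J x = j + 1 → x ∈ B j) := by
  classical
  let C : ℕ → Set 𝒳 := fun j => {x | x ∈ B j ∧ ∀ i > j, x ∉ B i}
  have hC : ∀ j, MeasurableSet (C j) := by
    intro j
    have : C j = B j ∩ ⋂ i, ⋂ (_ : i > j), (B i)ᶜ := by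
      ext x; simp [C]
    rw [this]
    exact (hB j).inter (MeasurableSet.iInter fun i => MeasurableSet.iInter fun _ => (hB i).compl)
  have huniq : ∀ x i j, x ∈ C i → x ∈ C j → i = j := by
    intro x i j hi hj
    rcases lt_trichotomy i j with h | h | h
    · exact absurd hj.1 (hi.2 j h)
    · exact h
    · exact absurd hi.1 (hj.2 i h)
  let J : 𝒳 → ℕ := fun x => if h : ∃ j, x ∈ C j then h.choose + 1 else 0
  have hJ1 : ∀ x j, x ∈ C j → J x = j + 1 := by
    intro x j hx
    have h : ∃ j, x ∈ C j := ⟨j, hx⟩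
    simp only [J, dif_pos h]
    rw [huniq x _ _ h.choose_spec hx]
  have hJ2 : ∀ x j, J x = j + 1 → x ∈ C j := by
    intro x j hx
    by_cases h : ∃ j, x ∈ C j
    · simp only [J, dif_pos h] at hx
      have := h.choose_spec
      rwa [Nat.succ_injective hx] at this
    · simp [J, dif_neg h] at hx
  have hJsucc : ∀ j, J ⁻¹' {j + 1} = C j := fun j =>
    Set.ext fun x => ⟨hJ2 x j, hJ1 x j⟩
  refine ⟨J, measurable_to_countable' fun n => ?_, fun x j h1 h2 => hJ1 x j ⟨h1, h2⟩,
    fun x j h => (hJ2 x j h).1⟩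
  cases n with
  | succ j => rw [hJsucc]; exact hC j
  | zero =>
    have : J ⁻¹' {0} = (⋃ j, C j)ᶜ := by
      ext x
      simp only [Set.mem_preimage, Set.mem_singleton_iff, Set.mem_compl_iff, Set.mem_iUnion]
      constructor
      · rintro h ⟨j, hj⟩
        rw [hJ1 x j hj] at h
        omega
      · intro h
        exact dif_neg h
    rw [this]
    exact (MeasurableSet.iUnion hC).compl

theorem aux_greedy {𝒴 : Type*} [Nonempty 𝒴] (Q : ℕ → (ℕ → 𝒴) → Prop)
    (hQ : ∀ j l, ∃ y, Q j (Function.update l (j + 1) y))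
    (hdep : ∀ j l l', (∀ i ≤ j + 1, l i = l' i) → Q j l → Q j l') :
    ∃ l, ∀ j, Q j l := by
  choose c hc using hQ
  let L : ℕ → (ℕ → 𝒴) := fun n => Nat.rec (fun _ => Classical.arbitrary 𝒴)
    (fun j l => Function.update l (j + 1) (c j l)) n
  have hL : ∀ j, L (j + 1) = Function.update (L j) (j + 1) (c j (L j)) := fun j => rfl
  have hstab : ∀ i d, L (i + d) i = L i i := by
    intro i d
    induction d with
    | zero => rfl
    | succ d ih =>
      rw [← add_assoc, hL, Function.update_of_ne (by omega), ih]
  refine ⟨fun i => L i i, fun j => hdep j (L (j + 1)) _ ?_ ?_⟩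
  · intro i hi
    obtain ⟨d, hd⟩ := Nat.exists_eq_add_of_le hi
    rw [hd]
    exact hstab i d
  · rw [hL]
    exact hc j _

/-- The memorization rule along a list of indices. -/
def auxMem {𝒳 𝒴 : Type*} (y0 : 𝒴) {t : ℕ} (xs : Fin t → 𝒳) (ys : Fin t → 𝒴) (x : 𝒳) :
    List (Fin t) → 𝒴
  | [] => y0
  | s :: L => open Classical in if xs s = x then ys s else auxMem y0 xs ys x L

theorem auxMem_measurable {𝒳 𝒴 : Type*} [MeasurableSpace 𝒳] [MeasurableEq 𝒳]
    [MeasurableSpace 𝒴] (y0 : 𝒴) {t : ℕ} (L : List (Fin t)) :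
    Measurable fun p : (Fin t → 𝒳) × (Fin t → 𝒴) × 𝒳 => auxMem y0 p.1 p.2.1 p.2.2 L := by
  classical
  induction L with
  | nil => exact measurable_const
  | cons s L ih =>
    simp only [auxMem]
    refine Measurable.ite ?_ ?_ ih
    · exact measurableSet_eq_fun ((measurable_pi_apply s).comp measurable_fst)
        (measurable_snd.comp measurable_snd)
    · exact (measurable_pi_apply s).comp (measurable_fst.comp measurable_snd)

theorem auxMem_spec {𝒳 𝒴 : Type*} (y0 : 𝒴) {t : ℕ} (xs : Fin t → 𝒳) (g : 𝒳 → 𝒴) (x : 𝒳)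
    (L : List (Fin t)) (h : ∃ s ∈ L, xs s = x) :
    auxMem y0 xs (fun s => g (xs s)) x L = g x := by
  classical
  induction L with
  | nil => simp at h
  | cons s L ih =>
    simp only [auxMem]
    split_ifs with hs
    · rw [hs]
    · apply ih
      obtain ⟨s', hs', hx⟩ := h
      rcases List.mem_cons.1 hs' with rfl | h'
      · exact absurd hx hs
      · exact ⟨s', h', hx⟩

theorem aux_backward {𝒳 𝒴 Ω : Type*} [MeasurableSpace 𝒳] [MeasurableEq 𝒳] [MeasurableSpace 𝒴]
    (ℓ : 𝒴 → 𝒴 → ℝ) (y0 : 𝒴)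
    (hℓnonneg : ∀ y y' : 𝒴, 0 ≤ ℓ y y')
    (hℓrefl : ∀ y : 𝒴, ℓ y y = 0)
    [MeasurableSpace Ω] (P : Measure Ω)
    (X : ℕ → Ω → 𝒳) (hFS : FS P X) :
    (∃ f : (t : ℕ) → (Fin t → 𝒳) → (Fin t → 𝒴) → 𝒳 → 𝒴,
        IsOnlineLearningRule f ∧ StronglyUniversallyConsistent P ℓ f X) := by
  refine ⟨fun t xs ys x => auxMem y0 xs ys x (List.finRange t),
    fun t => auxMem_measurable y0 _, fun g hg => ?_⟩
  filter_upwards [hFS] with ω hω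
  let c : ℕ → ℝ := fun t => ℓ (auxMem y0 (fun s : Fin t => X s ω) (fun s : Fin t => g (X s ω))
    (X t ω) (List.finRange t)) (g (X t ω))
  have hfin : {t | ∀ s < t, X s ω ≠ X t ω}.Finite := by
    refine Set.Finite.of_finite_image (f := fun t => X t ω)
      (hω.subset (Set.image_subset_range _ _)) ?_
    intro s hs t ht h
    rcases lt_trichotomy s t with h' | h' | h'
    · exact absurd h (ht s h')
    · exact h'
    · exact absurd h.symm (hs t h')
  have hc0 : ∀ t, t ∉ hfin.toFinset → c t = 0 := by
    intro t ht
    simp only [Set.Finite.mem_toFinset, Set.mem_setOf_eq, not_forall, not_not] at ht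
    obtain ⟨s, hs, hst⟩ := ht
    have := auxMem_spec y0 (fun s : Fin t => X s ω) g (X t ω) (List.finRange t)
      ⟨⟨s, hs⟩, List.mem_finRange _, hst⟩
    simp only [c, this, hℓrefl]
  have hbd : ∀ T, ∑ t ∈ range T, c t ≤ ∑ t ∈ hfin.toFinset, c t := by
    intro T
    calc ∑ t ∈ range T, c t ≤ ∑ t ∈ range T ∪ hfin.toFinset, c t :=
          sum_le_sum_of_subset_of_nonneg subset_union_left fun _ _ _ => hℓnonneg _ _
      _ = _ := (sum_subset subset_union_right fun t _ ht => hc0 t ht).symm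
  have hlim : Tendsto (fun T : ℕ => (∑ t ∈ range T, c t) / (T : ℝ)) atTop (nhds 0) := by
    refine squeeze_zero (fun T => div_nonneg (sum_nonneg fun _ _ => hℓnonneg _ _) (by positivity))
      (fun T => div_le_div_of_nonneg_right (hbd T) (by positivity)) ?_
    exact tendsto_const_nhds.div_atTop tendsto_natCast_atTop_atTop
  have := (continuous_coe_real_ereal.tendsto 0).comp hlim
  exact this.limsup_eq

theorem aux_avg_measurable {𝒳 𝒴 Ω : Type*} [MeasurableSpace 𝒳] [MeasurableSpace 𝒴]
    (ℓ : 𝒴 → 𝒴 → ℝ) (hℓmeas : Measurable fun p : 𝒴 × 𝒴 => ℓ p.1 p.2)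
    [MeasurableSpace Ω] (X : ℕ → Ω → 𝒳) (hX : ∀ t, Measurable (X t))
    (f : (t : ℕ) → (Fin t → 𝒳) → (Fin t → 𝒴) → 𝒳 → 𝒴) (hf : IsOnlineLearningRule f)
    (g : 𝒳 → 𝒴) (hg : Measurable g) (T : ℕ) : Measurable (avgLoss ℓ f X g T) := by
  unfold avgLoss
  refine Measurable.div_const (Finset.measurable_fun_sum _ fun t _ => ?_) _
  have h1 : Measurable fun ω => f t (fun s : Fin t => X s ω) (fun s : Fin t => g (X s ω))
      (X t ω) := by
    refine (hf t).comp (Measurable.prodMk (measurable_pi_lambda _ fun s => hX s)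
      (Measurable.prodMk (measurable_pi_lambda _ fun s => hg.comp (hX s)) (hX t)))
  exact hℓmeas.comp (h1.prodMk (hg.comp (hX t)))

theorem aux_forward {𝒳 𝒴 Ω : Type*} [MeasurableSpace 𝒳] [MeasurableSpace.CountablySeparated 𝒳]
    [MeasurableSpace 𝒴]
    (ℓ : 𝒴 → 𝒴 → ℝ) (cℓ : ℝ)
    (hℓmeas : Measurable fun p : 𝒴 × 𝒴 => ℓ p.1 p.2)
    (hℓnonneg : ∀ y y' : 𝒴, 0 ≤ ℓ y y')
    (hℓtri : ∀ y₁ y₂ y₃ : 𝒴, ℓ y₁ y₃ ≤ cℓ * (ℓ y₂ y₁ + ℓ y₂ y₃))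
    (hℓunbounded : ∀ C : ℝ, ∃ y y' : 𝒴, C < ℓ y y')
    [MeasurableSpace Ω] (P : Measure Ω) [IsProbabilityMeasure P]
    (X : ℕ → Ω → 𝒳) (hX : ∀ t, Measurable (X t))
    (f : (t : ℕ) → (Fin t → 𝒳) → (Fin t → 𝒴) → 𝒳 → 𝒴)
    (hf : IsOnlineLearningRule f) (hcons : StronglyUniversallyConsistent P ℓ f X) : FS P X := by
  classical
  by_contra hFS
  have ha0 : P {ω | ¬ (Set.range fun t => X t ω).Finite} ≠ 0 := fun h => hFS (ae_iff.2 h)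
  set a := P {ω | ¬ (Set.range fun t => X t ω).Finite} with hadef
  have hatop : a ≠ ⊤ := measure_ne_top _ _
  let b := a / 2 / 2 / 2
  have hb4 : b + b + (b + b) = a / 2 := by
    simp only [b, ENNReal.add_halves]
  have hb0 : b ≠ 0 := by simp [b, ha0]
  have hlt : a / 2 < a := ENNReal.half_lt_self ha0 hatop
  have hcpos : 0 < cℓ := by
    by_contra hc
    obtain ⟨y, y', hy⟩ := hℓunbounded 0
    have h1 := hℓtri y y y'
    have h2 := hℓnonneg y y
    nlinarith
  haveI : Nonempty 𝒴 := ⟨(hℓunbounded 0).choose⟩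
  obtain ⟨δ, hδpos, hδsum⟩ := ENNReal.exists_pos_sum_of_countable' hb0 ℕ
  have hstep : ∀ (j k : ℕ), ∃ B : Set 𝒳, MeasurableSet B ∧ ∃ k' > k,
      P {ω | ∃ s < k, X s ω ∈ B} ≤ δ j ∧ a / 2 ≤ P {ω | ∃ t < k', X t ω ∈ B} + δ j :=
    fun j k => aux_hit P X hX (a / 2) hlt k (δ j) (hδpos j).ne'
  choose Bf hBm Kf hKgt hearly hlate using hstep
  let K : ℕ → ℕ := fun n => Nat.rec 0 (fun j k => Kf j k) n
  have hK : ∀ j, K (j + 1) = Kf j (K j) := fun j => rfl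
  have hKmono : StrictMono K := strictMono_nat_of_lt_succ fun j => hKgt j (K j)
  let B : ℕ → Set 𝒳 := fun j => Bf j (K j)
  obtain ⟨J, hJm, hJ1, hJ2⟩ := aux_J B fun j => hBm j (K j)
  let F : ℕ → Set Ω := fun j => {ω | ∃ s < K j, X s ω ∈ B j}
  let Nn : ℕ → Set Ω := fun j => ⋃ i, ⋃ (_ : j < i), F i
  have hNn : ∀ j, P (Nn j) < b := by
    intro j
    refine lt_of_le_of_lt ?_ hδsum
    refine (measure_mono (t := ⋃ i, F i) ?_).trans ((measure_iUnion_le _).trans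
      (ENNReal.tsum_le_tsum fun i => hearly i (K i)))
    exact Set.iUnion_mono fun i => Set.iUnion_subset fun _ => subset_rfl
  let E : ℕ → Set Ω := fun j => {ω | ∃ t < K (j + 1), X t ω ∈ B j}
  let S : ℕ → (ℕ → 𝒴) → Set Ω := fun j l => {ω | ω ∉ Nn j ∧ ∃ t < K (j + 1),
    (K (j + 1) : ℝ) ≤ ℓ (f t (fun s : Fin t => X s ω) (fun s : Fin t => l (J (X s ω))) (X t ω))
      (l (J (X t ω)))}
  have hnot : ∀ j ω, ω ∉ Nn j → ∀ t < K (j + 1), ∀ i > j, X t ω ∉ B i := by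
    intro j ω hω t ht i hi hmem
    refine hω (Set.mem_iUnion₂.2 ⟨i, hi, t, ht.trans_le (hKmono.monotone hi), hmem⟩)
  have hJle : ∀ j ω, ω ∉ Nn j → ∀ t < K (j + 1), J (X t ω) ≤ j + 1 := by
    intro j ω hω t ht
    by_contra hcon
    obtain ⟨i, hi⟩ : ∃ i, J (X t ω) = i + 1 := Nat.exists_eq_succ_of_ne_zero (by omega)
    exact hnot j ω hω t ht i (by omega) (hJ2 _ _ hi)
  obtain ⟨l, hl⟩ := aux_greedy (fun j l => b ≤ P (S j l)) (by
    intro j l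
    obtain ⟨y, y', hy⟩ := hℓunbounded (cℓ * (2 * K (j + 1)))
    by_contra! hcon
    have h1 := hcon y
    have h2 := hcon y'
    have hcover : E j ⊆ (S j (Function.update l (j + 1) y) ∪ S j (Function.update l (j + 1) y'))
        ∪ Nn j := by
      intro ω hω
      by_cases hN : ω ∈ Nn j
      · exact Or.inr hN
      left
      have hex : ∃ t, t < K (j + 1) ∧ X t ω ∈ B j := hω
      let t := Nat.find hex
      have ht : t < K (j + 1) ∧ X t ω ∈ B j := Nat.find_spec hex
      have hmin : ∀ s < t, X s ω ∉ B j := fun s hs hs' =>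
        Nat.find_min hex hs ⟨hs.trans ht.1, hs'⟩
      have hJt : J (X t ω) = j + 1 := hJ1 _ _ ht.2 (hnot j ω hN t ht.1)
      have hhist : ∀ z, (fun s : Fin t => Function.update l (j + 1) z (J (X s ω)))
          = fun s : Fin t => l (J (X s ω)) := by
        intro z
        funext s
        rw [Function.update_of_ne]
        intro h
        exact hmin s s.2 (hJ2 _ _ h)
      have htri := hℓtri y (f t (fun s : Fin t => X s ω) (fun s : Fin t => l (J (X s ω))) (X t ω)) y'
      have h3 := lt_of_mul_lt_mul_left (hy.trans_le htri) hcpos.le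
      by_cases h4 : (K (j + 1) : ℝ) ≤
          ℓ (f t (fun s : Fin t => X s ω) (fun s : Fin t => l (J (X s ω))) (X t ω)) y
      · left
        refine ⟨hN, t, ht.1, ?_⟩
        rw [hhist, hJt, Function.update_self]
        exact h4
      · right
        refine ⟨hN, t, ht.1, ?_⟩
        rw [hhist, hJt, Function.update_self]
        linarith
    have h5 : a / 2 ≤ P (E j) + δ j := hlate j (K j)
    have h6 : P (E j) ≤ P (S j (Function.update l (j + 1) y)) +
        P (S j (Function.update l (j + 1) y')) + P (Nn j) :=
      (measure_mono hcover).trans ((measure_union_le _ _).trans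
        (add_le_add_left (measure_union_le _ _) _))
    have h7 : δ j < b := (ENNReal.le_tsum j).trans_lt hδsum
    have h8 : a / 2 ≤ (P (S j (Function.update l (j + 1) y)) +
        P (S j (Function.update l (j + 1) y'))) + (P (Nn j) + δ j) := by
      rw [← add_assoc]
      exact h5.trans (add_le_add_left h6 _)
    have h9 := ENNReal.add_lt_add (ENNReal.add_lt_add h1 h2) (ENNReal.add_lt_add (hNn j) h7)
    rw [hb4] at h9
    exact absurd h8 (not_le.2 h9)) (by
    intro j l l' hll h
    have : S j l = S j l' := by
      ext ω
      refine and_congr_right fun hN => exists_congr fun t => and_congr_right fun ht => ?_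
      have e1 : (fun s : Fin t => l (J (X s ω))) = fun s : Fin t => l' (J (X s ω)) :=
        funext fun s => hll _ (hJle j ω hN s (s.2.trans ht))
      rw [e1, hll _ (hJle j ω hN t ht)]
    rwa [← this])
  let g : 𝒳 → 𝒴 := fun x => l (J x)
  have hg : Measurable g := (measurable_from_top (f := l)).comp hJm
  have hSW : ∀ j, S j l ⊆ {ω | 1 ≤ avgLoss ℓ f X g (K (j + 1)) ω} := by
    rintro j ω ⟨-, t, ht, hloss⟩
    have hpos : (0 : ℝ) < K (j + 1) := by exact_mod_cast (Nat.zero_le t).trans_lt ht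
    change 1 ≤ avgLoss ℓ f X g (K (j + 1)) ω
    unfold avgLoss
    rw [le_div_iff₀ hpos, one_mul]
    exact hloss.trans (single_le_sum (f := fun t => ℓ (f t (fun s : Fin t => X s ω)
      (fun s : Fin t => g (X s ω)) (X t ω)) (g (X t ω))) (fun _ _ => hℓnonneg _ _)
      (mem_range.2 ht))
  have hnn : ∀ T ω, 0 ≤ avgLoss ℓ f X g T ω := fun T ω =>
    div_nonneg (sum_nonneg fun _ _ => hℓnonneg _ _) (by positivity)
  have hae : ∀ᵐ ω ∂P, Tendsto (fun j => avgLoss ℓ f X g (K (j + 1)) ω) atTop (nhds 0) := by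
    filter_upwards [hcons g hg] with ω hω
    have : Tendsto (fun T => avgLoss ℓ f X g T ω) atTop (nhds 0) := by
      rw [Metric.tendsto_nhds]
      intro ε hε
      have h1 : limsup (fun T : ℕ => ((avgLoss ℓ f X g T ω : ℝ) : EReal)) atTop < (ε : EReal) := by
        rw [hω]; exact_mod_cast hε
      filter_upwards [eventually_lt_of_limsup_lt h1] with T hT
      rw [Real.dist_eq, sub_zero, abs_of_nonneg (hnn T ω)]
      exact_mod_cast hT
    exact this.comp (hKmono.tendsto_atTop.comp (tendsto_add_atTop_nat 1))
  have hmeas := tendstoInMeasure_of_tendsto_ae (μ := P)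
    (f := fun j ω => avgLoss ℓ f X g (K (j + 1)) ω) (g := fun _ => (0 : ℝ))
    (fun j => (aux_avg_measurable ℓ hℓmeas X hX f hf g hg _).aestronglyMeasurable) hae
  have h1 := hmeas 1 one_pos
  have h2 := (h1.eventually_lt_const (pos_iff_ne_zero.2 hb0)).exists
  obtain ⟨j, hj⟩ := h2
  refine absurd ((hl j).trans (measure_mono ((hSW j).trans ?_))) (not_le.2 hj)
  intro ω hω
  have hω : 1 ≤ avgLoss ℓ f X g (K (j + 1)) ω := hω
  simp only [Set.mem_setOf_eq, edist_dist, Real.dist_eq, sub_zero, abs_of_nonneg (hnn _ ω)]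
  exact ENNReal.one_le_ofReal.2 hω

/-- **Theorem (SUOL = FS).** Let `𝒳` be a separable metric space (with its Borel σ-algebra),
`𝒴` a measurable value space, and `ℓ` an unbounded measurable loss satisfying `ℓ y y = 0` and a
relaxed triangle inequality with finite constant `cℓ`. A stochastic process `X` on `𝒳` admits a
strongly universally consistent online learning rule iff it almost surely takes only finitely
many distinct values. -/
theorem suol_eq_fs {𝒳 𝒴 Ω : Type*} [MetricSpace 𝒳] [TopologicalSpace.SeparableSpace 𝒳]
    [MeasurableSpace 𝒳] [BorelSpace 𝒳] [MeasurableSpace 𝒴]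
    (ℓ : 𝒴 → 𝒴 → ℝ) (cℓ : ℝ)
    (hℓmeas : Measurable fun p : 𝒴 × 𝒴 => ℓ p.1 p.2)
    (hℓnonneg : ∀ y y' : 𝒴, 0 ≤ ℓ y y')
    (hℓrefl : ∀ y : 𝒴, ℓ y y = 0)
    (hℓtri : ∀ y₁ y₂ y₃ : 𝒴, ℓ y₁ y₃ ≤ cℓ * (ℓ y₂ y₁ + ℓ y₂ y₃))
    (hℓunbounded : ∀ C : ℝ, ∃ y y' : 𝒴, C < ℓ y y')
    [MeasurableSpace Ω] (P : Measure Ω) [IsProbabilityMeasure P]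
    (X : ℕ → Ω → 𝒳) (hX : ∀ t, Measurable (X t)) :
    (∃ f : (t : ℕ) → (Fin t → 𝒳) → (Fin t → 𝒴) → 𝒳 → 𝒴,
        IsOnlineLearningRule f ∧ StronglyUniversallyConsistent P ℓ f X) ↔ FS P X := by
  haveI : SecondCountableTopology 𝒳 := UniformSpace.secondCountable_of_separable 𝒳
  constructor
  · rintro ⟨f, hf, hcons⟩
    exact aux_forward ℓ cℓ hℓmeas hℓnonneg hℓtri hℓunbounded P X hX f hf hcons
  · intro h
    exact aux_backward ℓ (hℓunbounded 0).choose hℓnonneg hℓrefl P X h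

end
end

section
/- Let 𝒳 be a separable metric space, 𝒴 a measurable value space and ℓ an unbounded loss function (satisfying ℓ(y,y)=0 and a relaxed triangle inequality with finite constant c_ℓ). Then the memorization rule is an optimistically universal online learning rule: for every stochastic process 𝕏 on 𝒳 under which some online learning rule is strongly universally consistent, the memorization rule is strongly universally consistent under 𝕏. -/
open MeasureTheory Filter Finset

noncomputable section

open Classical in
/-- The memorization rule with default prediction `y₀`: if the new point equals a previously
seen point, predict the corresponding recorded value; otherwise predict `y₀`. -/
def memorizationRule {𝒳 𝒴 : Type*} (y₀ : 𝒴) :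
    (t : ℕ) → (Fin t → 𝒳) → (Fin t → 𝒴) → 𝒳 → 𝒴 := fun t xs ys x =>
  if h : ∃ s : Fin t, xs s = x then ys h.choose else y₀


theorem aux_sum_measure_le {Ω ι : Type*} [MeasurableSpace Ω] (P : Measure Ω)
    [IsProbabilityMeasure P] [Fintype ι] (A : ι → Set Ω) (hA : ∀ i, MeasurableSet (A i))
    (M : ℝ) (hM : ∀ ω, (∑ i, (A i).indicator (fun _ => (1 : ℝ)) ω) ≤ M) :
    ∑ i, P.real (A i) ≤ M := by
  have h1 : ∀ i, P.real (A i) = ∫ ω, (A i).indicator (fun _ => (1 : ℝ)) ω ∂P := by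
    intro i
    rw [integral_indicator (hA i)]
    simp
  have hintg : ∀ i, Integrable ((A i).indicator (fun _ => (1 : ℝ))) P := fun i =>
    (integrable_const _).indicator (hA i)
  simp_rw [h1]
  rw [← integral_finsetSum _ (fun i _ => hintg i)]
  calc _ ≤ ∫ _, M ∂P := integral_mono (integrable_finsetSum _ (fun i _ => hintg i))
        (integrable_const _) hM
    _ = M := by simp

theorem aux_count_avoid {C : Type*} [Fintype C] [DecidableEq C] (k : ℕ) (F : Finset C) :
    ((Finset.univ.filter (fun col : C → Fin (k + 1) => ∀ c ∈ F, col c ≠ 0)).card : ℝ)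
      = ((k : ℝ) + 1) ^ Fintype.card C * (k / (k + 1)) ^ F.card := by
  have : (Finset.univ.filter (fun col : C → Fin (k + 1) => ∀ c ∈ F, col c ≠ 0))
      = Fintype.piFinset (fun c => if c ∈ F then Finset.univ.erase 0 else Finset.univ) := by
    ext col
    simp only [mem_filter, Finset.mem_univ, true_and, Fintype.mem_piFinset]
    refine forall_congr' fun c => ?_
    by_cases hc : c ∈ F <;> simp [hc]
  rw [this, Fintype.card_piFinset]
  have h2 : ∀ c : C, ((if c ∈ F then Finset.univ.erase 0 else Finset.univ :
      Finset (Fin (k+1))).card : ℝ) = ((k : ℝ) + 1) * (if c ∈ F then (k / (k + 1) : ℝ) else 1) := by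
    intro c
    by_cases hc : c ∈ F
    · simp [hc]; field_simp
    · simp [hc]
  push_cast
  simp_rw [h2]
  rw [Finset.prod_mul_distrib]
  simp [div_pow]

theorem aux_count_hit {C : Type*} [Fintype C] [DecidableEq C] (k : ℕ) (c : C) :
    ((Finset.univ.filter (fun col : C → Fin (k + 1) => col c = 0)).card : ℝ)
      = ((k : ℝ) + 1) ^ Fintype.card C * (1 / (k + 1)) := by
  have h := aux_count_avoid k ({c} : Finset C)
  have h3 := Finset.card_filter_add_card_filter_not (s := (Finset.univ : Finset (C → Fin (k + 1))))
    (fun col => col c = 0)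
  have h4 : ((Finset.univ.filter (fun col : C → Fin (k + 1) => col c = 0)).card : ℝ) +
    ((Finset.univ.filter (fun col : C → Fin (k + 1) => ¬ col c = 0)).card : ℝ)
      = ((k : ℝ) + 1) ^ Fintype.card C := by
    rw [← Nat.cast_add, h3]; simp
  simp at h
  rw [h] at h4
  rw [eq_sub_of_add_eq h4]
  field_simp
  ring

/-- Averaging over random colourings of a finite set of cells. -/
theorem aux_average {Ω C : Type*} [MeasurableSpace Ω] (P : Measure Ω) [IsProbabilityMeasure P]
    [Fintype C] [DecidableEq C] [MeasurableSpace C] [MeasurableSingletonClass C]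
    (Y : ℕ → Ω → C) (hY : ∀ t, Measurable (Y t)) (T m N k : ℕ) (a b : ℝ) (ha : 0 ≤ a)
    (hb : 0 ≤ b) :
    ∃ D : Set C, a * ∑ t ∈ range T, P.real {ω | Y t ω ∈ D}
      + b * P.real {ω | N ≤ ((range m).image (fun t => Y t ω)).card ∧ ∀ t < m, Y t ω ∉ D}
      ≤ a * (T * (1 / (k + 1))) + b * (k / (k + 1)) ^ N := by
  classical
  let D : (C → Fin (k+1)) → Set C := fun col => {c | col c = 0}
  have hmeasD : ∀ S : Set C, MeasurableSet S := fun S => (Set.toFinite S).measurableSet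
  have hV : MeasurableSet {ω | N ≤ ((range m).image (fun t => Y t ω)).card} := by
    have h1 : Measurable (fun ω => fun t : Fin m => Y t ω) := measurable_pi_lambda _ fun t => hY t
    have h2 : {ω | N ≤ ((range m).image (fun t => Y t ω)).card} =
      (fun ω => fun t : Fin m => Y t ω) ⁻¹' {v | N ≤ ((univ : Finset (Fin m)).image v).card} := by
      ext ω
      simp only [Set.mem_ofPred_eq, Set.mem_preimage]
      have : (range m).image (fun t => Y t ω) = (univ : Finset (Fin m)).image (fun t : Fin m => Y t ω) := by
        ext c
        simp only [Finset.mem_image, Finset.mem_range, Finset.mem_univ, true_and]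
        constructor
        · rintro ⟨t, ht, h⟩; exact ⟨⟨t, ht⟩, h⟩
        · rintro ⟨t, h⟩; exact ⟨t, t.2, h⟩
      rw [this]
    rw [h2]
    exact h1 (Set.toFinite _).measurableSet
  have key := Finset.exists_le_of_sum_le (s := (univ : Finset (C → Fin (k+1)))) (f := fun col =>
      a * ∑ t ∈ range T, P.real {ω | Y t ω ∈ D col}
      + b * P.real {ω | N ≤ ((range m).image (fun t => Y t ω)).card ∧ ∀ t < m, Y t ω ∉ D col})
      (g := fun _ => a * (T * (1 / (k + 1))) + b * (k / (k + 1)) ^ N) univ_nonempty ?_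
  · obtain ⟨col, -, h⟩ := key
    exact ⟨D col, h⟩
  have hc : (0 : ℝ) < ((k : ℝ) + 1) ^ Fintype.card C := by positivity
  rw [Finset.sum_add_distrib, ← Finset.mul_sum, ← Finset.mul_sum, Finset.sum_comm, Finset.sum_const,
    nsmul_eq_mul]
  have e1 : ∀ t, ∑ col : C → Fin (k+1), P.real {ω | Y t ω ∈ D col} ≤
      ((k : ℝ) + 1) ^ Fintype.card C * (1 / (k + 1)) := by
    intro t
    refine aux_sum_measure_le P _ (fun col => hY t (hmeasD _)) _ fun ω => ?_
    rw [← aux_count_hit k (Y t ω), Finset.card_filter]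
    push_cast
    refine le_of_eq (Finset.sum_congr rfl fun col _ => ?_)
    simp [Set.indicator_apply, D]
  have e2 : ∑ col : C → Fin (k+1), P.real {ω | N ≤ ((range m).image (fun t => Y t ω)).card ∧ ∀ t < m, Y t ω ∉ D col} ≤
      ((k : ℝ) + 1) ^ Fintype.card C * (k / (k + 1)) ^ N := by
    refine aux_sum_measure_le P _ (fun col => ?_) _ fun ω => ?_
    · refine hV.inter ?_
      have : {ω | ∀ t < m, Y t ω ∉ D col} = ⋂ t, ⋂ (_ : t < m), (Y t) ⁻¹' (D col)ᶜ := by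
        ext ω; simp
      change MeasurableSet {ω | ∀ t < m, Y t ω ∉ D col}
      rw [this]
      exact MeasurableSet.iInter fun t => MeasurableSet.iInter fun _ => hY t (hmeasD _)
    · by_cases hN : N ≤ ((range m).image (fun t => Y t ω)).card
      · calc _ = ((Finset.univ.filter (fun col : C → Fin (k + 1) =>
                ∀ c ∈ (range m).image (fun t => Y t ω), col c ≠ 0)).card : ℝ) := by
              rw [Finset.card_filter]
              push_cast
              refine (Finset.sum_congr rfl fun col _ => ?_)
              simp [Set.indicator_apply, D, hN]
          _ ≤ _ := by
              rw [aux_count_avoid]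
              refine mul_le_mul_of_nonneg_left ?_ hc.le
              refine pow_le_pow_of_le_one (by positivity) ?_ hN
              rw [div_le_one (by positivity)]; linarith
      · simp [hN]
        positivity
  calc _ ≤ a * (∑ t ∈ range T, ((k : ℝ) + 1) ^ Fintype.card C * (1 / (k + 1))) +
        b * (((k : ℝ) + 1) ^ Fintype.card C * (k / (k + 1)) ^ N) := by
        gcongr with t ht
        exact e1 t
    _ = _ := by
        simp
        ring

theorem aux_small_hit {𝒳 Ω : Type*} [MeasurableSpace 𝒳] [MeasurableSpace.CountablySeparated 𝒳]
    [MeasurableSpace Ω] (P : Measure Ω) [IsProbabilityMeasure P]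
    (X : ℕ → Ω → 𝒳) (hX : ∀ t, Measurable (X t)) (δ : ℝ) (hδ : 0 < δ)
    (hinf : P {ω | (Set.range fun t => X t ω).Infinite} = ENNReal.ofReal δ)
    (T : ℕ) (ε : ℝ) (hε : 0 < ε) :
    ∃ (D : Set 𝒳) (m : ℕ), MeasurableSet D ∧ T ≤ m ∧
      ∑ t ∈ range T, P.real {ω | X t ω ∈ D} ≤ ε ∧
      δ / 4 ≤ P.real {ω | ∃ t < m, X t ω ∈ D} := by
  classical
  obtain ⟨e, he, hinj⟩ := MeasurableSpace.measurable_injection_nat_bool_of_countablySeparated 𝒳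
  obtain ⟨k, hk⟩ := exists_nat_gt (2 * T / ε)
  obtain ⟨N, hN⟩ := exists_pow_lt_of_lt_one (show 0 < δ / 8 by positivity)
    (show (k : ℝ) / (k + 1) < 1 by rw [div_lt_one (by positivity)]; linarith)
  let pr : (m : ℕ) → 𝒳 → (Fin m → Bool) := fun m x i => e x i
  have hpr : ∀ m, Measurable (pr m) := fun m =>
    measurable_pi_lambda _ fun i => (measurable_pi_apply _).comp he
  let V : ℕ → Set Ω := fun m => {ω | N ≤ ((range m).image (fun t => pr m (X t ω))).card}
  have hVmono : Monotone V := by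
    intro m m' hm ω hω
    refine le_trans (show N ≤ _ from hω) ?_
    have : (range m).image (fun t => pr m (X t ω)) =
        ((range m).image (fun t => pr m' (X t ω))).image
          (fun v => fun i : Fin m => v (Fin.castLE hm i)) := by
      rw [Finset.image_image]
      rfl
    rw [this]
    exact card_image_le.trans (card_le_card (image_subset_image (range_mono hm)))
  have hcover : {ω | (Set.range fun t => X t ω).Infinite} ⊆ ⋃ m, V m := by
    intro ω hω
    obtain ⟨u, hu, hucard⟩ := Set.Infinite.exists_subset_card_eq hω N
    have h1 : ∀ᶠ m in atTop, ∀ x ∈ u, ∀ y ∈ u, x ≠ y → pr m x ≠ pr m y := by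
      rw [Filter.eventually_all_finset]
      intro x _
      rw [Filter.eventually_all_finset]
      intro y _
      by_cases hxy : x = y
      · simp [hxy]
      obtain ⟨i, hi⟩ := Function.ne_iff.1 (hinj.ne hxy)
      filter_upwards [eventually_gt_atTop i] with m hm _ heq
      exact hi (congrFun heq ⟨i, hm⟩)
    have h2 : ∀ᶠ m in atTop, ∀ x ∈ u, ∃ t < m, X t ω = x := by
      rw [Filter.eventually_all_finset]
      intro x hx
      obtain ⟨t, ht⟩ := hu hx
      filter_upwards [eventually_gt_atTop t] with m hm
      exact ⟨t, hm, ht⟩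
    obtain ⟨m, hm1, hm2⟩ := (h1.and h2).exists
    refine Set.mem_iUnion.2 ⟨m, ?_⟩
    change N ≤ _
    rw [← hucard, ← Finset.card_image_of_injOn (f := pr m) (s := u)]
    · refine card_le_card ?_
      intro v hv
      obtain ⟨x, hx, rfl⟩ := Finset.mem_image.1 hv
      obtain ⟨t, ht, rfl⟩ := hm2 x hx
      exact Finset.mem_image.2 ⟨t, Finset.mem_range.2 ht, rfl⟩
    · intro x hx y hy hxy
      by_contra hne
      exact hm1 x hx y hy hne hxy
  have hlim := tendsto_measure_iUnion_atTop (μ := P) hVmono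
  have hlt : ENNReal.ofReal (δ / 2) < P (⋃ m, V m) := by
    refine lt_of_lt_of_le ?_ (measure_mono hcover)
    rw [hinf]
    exact (ENNReal.ofReal_lt_ofReal_iff hδ).2 (by linarith)
  obtain ⟨m, hm, hTm⟩ := ((hlim.eventually (lt_mem_nhds hlt)).and (eventually_ge_atTop T)).exists
  have hm' : δ / 2 ≤ P.real (V m) := by
    rw [Measure.real, ← ENNReal.ofReal_le_iff_le_toReal (measure_ne_top _ _)]
    exact hm.le
  obtain ⟨D, hD⟩ := aux_average P (fun t ω => pr m (X t ω)) (fun t => (hpr m).comp (hX t)) T m N k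
    (1 / ε) (4 / δ) (by positivity) (by positivity)
  have hle : 1 / ε * (T * (1 / ((k : ℝ) + 1))) + 4 / δ * (k / (k + 1)) ^ N ≤ 1 := by
    have a1 : 1 / ε * (T * (1 / ((k : ℝ) + 1))) ≤ 1 / 2 := by
      rw [div_lt_iff₀ hε] at hk
      have : 1 / ε * (T * (1 / ((k : ℝ) + 1))) = T / (ε * (k + 1)) := by field_simp
      rw [this, div_le_iff₀ (by positivity)]
      nlinarith
    have a2 : 4 / δ * ((k : ℝ) / (k + 1)) ^ N ≤ 4 / δ * (δ / 8) := by gcongr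
    have a3 : 4 / δ * (δ / 8) = 1 / 2 := by field_simp; norm_num
    linarith
  have hD1 := hD.trans hle
  set q := ∑ t ∈ range T, P.real {ω | pr m (X t ω) ∈ D} with hq
  set r := P.real {ω | N ≤ ((range m).image (fun t => pr m (X t ω))).card ∧
    ∀ t < m, pr m (X t ω) ∉ D} with hr
  have hq0 : 0 ≤ q := Finset.sum_nonneg fun _ _ => measureReal_nonneg
  have hr0 : 0 ≤ r := measureReal_nonneg
  have hqe : q ≤ ε := by
    have : 1 / ε * q ≤ 1 := le_trans (le_add_of_nonneg_right (by positivity)) hD1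
    rwa [one_div_mul_eq_div, div_le_one hε] at this
  have hre : r ≤ δ / 4 := by
    have : 4 / δ * r ≤ 1 := le_trans (le_add_of_nonneg_left (by positivity)) hD1
    rw [div_mul_eq_mul_div, div_le_one hδ] at this
    linarith
  refine ⟨pr m ⁻¹' D, m, hpr m (Set.toFinite D).measurableSet, hTm, hqe, ?_⟩
  have hsub : V m ⊆ {ω | ∃ t < m, X t ω ∈ pr m ⁻¹' D} ∪
      {ω | N ≤ ((range m).image (fun t => pr m (X t ω))).card ∧ ∀ t < m, pr m (X t ω) ∉ D} := by
    intro ω hω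
    by_cases h : ∃ t < m, X t ω ∈ pr m ⁻¹' D
    · exact Or.inl h
    · right
      push Not at h
      exact ⟨hω, h⟩
  have := (measureReal_mono hsub (measure_ne_top P _)).trans (measureReal_union_le _ _)
  linarith

theorem aux_partition {𝒳 Ω : Type*} [MeasurableSpace 𝒳] [MeasurableSpace.CountablySeparated 𝒳]
    [MeasurableSpace Ω] (P : Measure Ω) [IsProbabilityMeasure P]
    (X : ℕ → Ω → 𝒳) (hX : ∀ t, Measurable (X t)) (δ : ℝ) (hδ : 0 < δ)
    (hinf : P {ω | (Set.range fun t => X t ω).Infinite} = ENNReal.ofReal δ) :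
    ∃ (g : 𝒳 → ℕ) (T : ℕ → ℕ), Measurable g ∧
      ∀ k, ENNReal.ofReal (δ / 8) ≤ P {ω | ∃ t < T k, g (X t ω) = k} := by
  classical
  have hstep : ∀ (T n : ℕ), ∃ (p : Set 𝒳 × ℕ), MeasurableSet p.1 ∧ T ≤ p.2 ∧
      ∑ t ∈ range T, P.real {ω | X t ω ∈ p.1} ≤ δ / 16 * (1 / 2) ^ n ∧
      δ / 4 ≤ P.real {ω | ∃ t < p.2, X t ω ∈ p.1} := by
    intro T n
    obtain ⟨D, m, h⟩ := aux_small_hit P X hX δ hδ hinf T (δ / 16 * (1 / 2) ^ n) (by positivity)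
    exact ⟨(D, m), h⟩
  choose F hF1 hF2 hF3 hF4 using hstep
  let S : ℕ → ℕ := fun n => Nat.rec 0 (fun n T => (F T n).2) n
  have hS : ∀ n, S (n + 1) = (F (S n) n).2 := fun n => rfl
  let D : ℕ → Set 𝒳 := fun n => (F (S n) n).1
  have hSmono : Monotone S := monotone_nat_of_le_succ fun n => by rw [hS]; exact hF2 _ _
  have hDm : ∀ n, MeasurableSet (D n) := fun n => hF1 _ _
  refine ⟨fun x => ⨆ n, (D n).indicator (fun _ => n) x, fun k => S (k + 1), ?_, fun k => ?_⟩
  · exact Measurable.iSup fun n => measurable_const.indicator (hDm n)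
  have hbad : P (⋃ n, {ω | ∃ t < S (k + 1), X t ω ∈ D (k + 1 + n)}) ≤ ENNReal.ofReal (δ / 8) := by
    have h1 : ∀ n, P {ω | ∃ t < S (k + 1), X t ω ∈ D (k + 1 + n)}
        ≤ ENNReal.ofReal (δ / 16 * (1 / 2) ^ n) := by
      intro n
      have hsub : {ω | ∃ t < S (k + 1), X t ω ∈ D (k + 1 + n)} ⊆
          ⋃ t ∈ range (S (k + 1 + n)), {ω | X t ω ∈ D (k + 1 + n)} := by
        rintro ω ⟨t, ht, h⟩
        have : t < S (k + 1 + n) := lt_of_lt_of_le ht (hSmono (show k + 1 ≤ k + 1 + n by omega))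
        simp only [Set.mem_iUnion]
        exact ⟨t, Finset.mem_range.2 this, h⟩
      have h2 : P.real {ω | ∃ t < S (k + 1), X t ω ∈ D (k + 1 + n)} ≤ δ / 16 * (1 / 2) ^ n := by
        refine (measureReal_mono hsub (measure_ne_top P _)).trans ?_
        refine (measureReal_biUnion_finset_le _ _).trans ?_
        refine (hF3 (S (k + 1 + n)) (k + 1 + n)).trans ?_
        gcongr ?_ * ?_
        exact pow_le_pow_of_le_one (by norm_num) (by norm_num) (by omega)
      rw [← ofReal_measureReal]
      exact ENNReal.ofReal_le_ofReal h2
    refine (measure_iUnion_le _).trans ((ENNReal.tsum_le_tsum h1).trans ?_)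
    have hs : HasSum (fun n : ℕ => δ / 16 * (1 / 2 : ℝ) ^ n) (δ / 16 * 2) :=
      hasSum_geometric_two.mul_left _
    rw [← ENNReal.ofReal_tsum_of_nonneg (fun n => by positivity) hs.summable, hs.tsum_eq]
    exact ENNReal.ofReal_le_ofReal (by linarith)
  have hgood : ENNReal.ofReal (δ / 4) ≤ P {ω | ∃ t < S (k + 1), X t ω ∈ D k} := by
    rw [ENNReal.ofReal_le_iff_le_toReal (measure_ne_top _ _)]
    exact hF4 (S k) k
  have hsub : {ω | ∃ t < S (k + 1), X t ω ∈ D k} ⊆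
      {ω | ∃ t < S (k + 1), (⨆ n, (D n).indicator (fun _ => n) (X t ω)) = k} ∪
      ⋃ n, {ω | ∃ t < S (k + 1), X t ω ∈ D (k + 1 + n)} := by
    rintro ω ⟨t, ht, h⟩
    by_cases hb : ∃ n, X t ω ∈ D (k + 1 + n)
    · obtain ⟨n, hn⟩ := hb
      exact Or.inr (Set.mem_iUnion.2 ⟨n, t, ht, hn⟩)
    · left
      push Not at hb
      refine ⟨t, ht, ?_⟩
      have hle : ∀ n, (D n).indicator (fun _ => n) (X t ω) ≤ k := by
        intro n
        by_cases hn : X t ω ∈ D n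
        · simp only [hn, Set.indicator_of_mem]
          by_contra hlt
          exact hb (n - (k + 1)) (by rwa [Nat.add_sub_cancel' (show k + 1 ≤ n by omega)])
        · simp [hn]
      refine le_antisymm (ciSup_le hle) ?_
      have := le_ciSup (f := fun n => (D n).indicator (fun _ => n) (X t ω))
        ⟨k, by rintro _ ⟨n, rfl⟩; exact hle n⟩ k
      simpa [h] using this
  have h3 := hgood.trans ((measure_mono hsub).trans (measure_union_le _ _))
  have h4 := h3.trans (add_le_add_right hbad _)
  have h5 : ENNReal.ofReal (δ / 4) = ENNReal.ofReal (δ / 8) + ENNReal.ofReal (δ / 8) := by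
    rw [← ENNReal.ofReal_add (by positivity) (by positivity)]; congr 1; ring
  rw [h5] at h4
  exact (ENNReal.add_le_add_iff_right ENNReal.ofReal_ne_top).1 h4

theorem aux_bounded {u : ℕ → ℝ}
    (h : Filter.limsup (fun T : ℕ => ((u T : ℝ) : EReal)) atTop = 0) : ∃ M : ℕ, ∀ T, u T ≤ M := by
  have h1 : ∀ᶠ T in atTop, ((u T : ℝ) : EReal) < (1 : ℝ) :=
    Filter.eventually_lt_of_limsup_lt (by rw [h]; exact_mod_cast zero_lt_one)
  have h2 : ∀ᶠ T in atTop, u T ≤ 1 := by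
    filter_upwards [h1] with T hT
    exact (EReal.coe_lt_coe_iff.1 hT).le
  have h3 : BddAbove (Set.range u) :=
    Filter.IsBoundedUnder.bddAbove_range ⟨1, by simpa using h2⟩
  obtain ⟨M, hM⟩ := h3
  obtain ⟨M', hM'⟩ := exists_nat_ge M
  exact ⟨M', fun T => (hM ⟨T, rfl⟩).trans hM'⟩

/-- the fair coin -/
def fairCoin : Measure Bool :=
  ENNReal.ofReal (1 / 2) • Measure.dirac true + ENNReal.ofReal (1 / 2) • Measure.dirac false

instance : IsProbabilityMeasure fairCoin := by
  constructor
  simp only [fairCoin, Measure.coe_add, Measure.coe_smul, Pi.add_apply, Pi.smul_apply,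
    measure_univ, smul_eq_mul, mul_one]
  rw [← ENNReal.ofReal_add (by norm_num) (by norm_num)]
  norm_num

theorem fairCoin_map_not : fairCoin.map (fun b => !b) = fairCoin := by
  have hm : Measurable (fun b : Bool => !b) := measurable_of_countable _
  simp only [fairCoin]
  rw [Measure.map_add _ _ hm, Measure.map_smul, Measure.map_smul, Measure.map_dirac' hm,
    Measure.map_dirac' hm]
  simp [add_comm]

def flipBit (k : ℕ) (b : ℕ → Bool) : ℕ → Bool := fun i => (if i = k then fun c => !c else id) (b i)

theorem flip_preserving (k : ℕ) :
    MeasurePreserving (flipBit k) (Measure.infinitePi fun _ : ℕ => fairCoin)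
      (Measure.infinitePi fun _ : ℕ => fairCoin) := by
  have hm : ∀ i : ℕ, Measurable (if i = k then fun c : Bool => !c else id) :=
    fun i => measurable_of_countable _
  refine ⟨measurable_pi_lambda _ fun i => (hm i).comp (measurable_pi_apply i), ?_⟩
  have := Measure.infinitePi_map_pi (μ := fun _ : ℕ => fairCoin) (f := fun i =>
    if i = k then fun c : Bool => !c else id) hm
  refine Eq.trans this ?_
  congr 1
  funext i
  by_cases hi : i = k
  · simp only [hi, if_true]; exact fairCoin_map_not
  · simp [hi]

theorem aux_no_partition {𝒳 𝒴 Ω : Type*} [MeasurableSpace 𝒳] [MeasurableSpace 𝒴]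
    (ℓ : 𝒴 → 𝒴 → ℝ) (cℓ : ℝ)
    (hℓmeas : Measurable fun p : 𝒴 × 𝒴 => ℓ p.1 p.2)
    (hℓnonneg : ∀ y y' : 𝒴, 0 ≤ ℓ y y')
    (hℓtri : ∀ y₁ y₂ y₃ : 𝒴, ℓ y₁ y₃ ≤ cℓ * (ℓ y₂ y₁ + ℓ y₂ y₃))
    (hℓunbounded : ∀ C : ℝ, ∃ y y' : 𝒴, C < ℓ y y')
    [MeasurableSpace Ω] (P : Measure Ω) [IsProbabilityMeasure P]
    (X : ℕ → Ω → 𝒳) (hX : ∀ t, Measurable (X t))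
    (f : (t : ℕ) → (Fin t → 𝒳) → (Fin t → 𝒴) → 𝒳 → 𝒴)
    (hf : IsOnlineLearningRule f) (hc : StronglyUniversallyConsistent P ℓ f X)
    (g : 𝒳 → ℕ) (hg : Measurable g) (T : ℕ → ℕ) (r : ENNReal) (hr : 0 < r)
    (hhit : ∀ k, r ≤ P {ω | ∃ t < T k, g (X t ω) = k}) : False := by
  classical
  choose y y' hy using fun k : ℕ => hℓunbounded (max cℓ 0 * (2 * (k * T k)))
  let lab : ℕ → Bool → 𝒴 := fun k c => if c then y k else y' k
  let F : (ℕ → Bool) → 𝒳 → 𝒴 := fun b x => lab (g x) (b (g x))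
  have hFm : Measurable fun p : (ℕ → Bool) × 𝒳 => F p.1 p.2 := by
    have h1 : Measurable fun p : (ℕ → Bool) × ℕ => lab p.2 (p.1 p.2) :=
      measurable_from_prod_countable_left fun n =>
        (measurable_of_countable (lab n)).comp (measurable_pi_apply n)
    exact h1.comp (measurable_fst.prodMk (hg.comp measurable_snd))
  have hFb : ∀ b, Measurable (F b) := fun b => hFm.comp measurable_prodMk_left
  let pred : ℕ → (ℕ → Bool) → Ω → 𝒴 := fun t b ω =>
    f t (fun s : Fin t => X s ω) (fun s : Fin t => F b (X s ω)) (X t ω)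
  let L : ℕ → (ℕ → Bool) → Ω → ℝ := fun t b ω => ℓ (pred t b ω) (F b (X t ω))
  have hFX : ∀ t, Measurable fun p : (ℕ → Bool) × Ω => F p.1 (X t p.2) := fun t =>
    hFm.comp (measurable_fst.prodMk ((hX t).comp measurable_snd))
  have hLm : ∀ t, Measurable fun p : (ℕ → Bool) × Ω => L t p.1 p.2 := by
    intro t
    refine hℓmeas.comp (Measurable.prodMk ?_ (hFX t))
    refine (hf t).comp (Measurable.prodMk ?_ (Measurable.prodMk ?_ ?_))
    · exact measurable_pi_lambda _ fun s => (hX s).comp measurable_snd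
    · exact measurable_pi_lambda _ fun s => hFX s
    · exact (hX t).comp measurable_snd
  let μ := Measure.infinitePi fun _ : ℕ => fairCoin
  let E : ℕ → Set ((ℕ → Bool) × Ω) := fun k => {p | ∃ t : ℕ, (k : ℝ) * (t + 1) < L t p.1 p.2}
  have hEm : ∀ k, MeasurableSet (E k) := by
    intro k
    have : E k = ⋃ t : ℕ, {p | (k : ℝ) * (t + 1) < L t p.1 p.2} := by
      ext p; simp [E]
    rw [this]
    exact MeasurableSet.iUnion fun t => measurableSet_lt measurable_const (hLm t)
  have hEanti : Antitone E := by
    rintro k k' hkk p ⟨t, ht⟩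
    refine ⟨t, lt_of_le_of_lt ?_ ht⟩
    gcongr
  have hnull : (μ.prod P) (⋂ k, E k) = 0 := by
    rw [Measure.measure_prod_null (MeasurableSet.iInter hEm)]
    refine Filter.Eventually.of_forall fun b => ?_
    have := hc (F b) (hFb b)
    refine measure_mono_null ?_ (ae_iff.1 this)
    intro ω hω hlim
    obtain ⟨M, hM⟩ := aux_bounded hlim
    obtain ⟨t, ht⟩ := Set.mem_iInter.1 hω M
    have h1 := hM (t + 1)
    unfold avgLoss at h1
    rw [div_le_iff₀ (by positivity)] at h1
    have h2 : L t b ω ≤ ∑ t ∈ range (t + 1), L t b ω :=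
      Finset.single_le_sum (f := fun t => L t b ω) (fun i _ => hℓnonneg _ _)
        (Finset.self_mem_range_succ t)
    push_cast at h1
    exact absurd (h2.trans h1) (not_le.2 ht)
  have hlow : ∀ k, r ≤ 2 * (μ.prod P) (E k) := by
    intro k
    have hpres : MeasurePreserving (Prod.map (flipBit k) id) (μ.prod P) (μ.prod P) :=
      (flip_preserving k).prod (MeasurePreserving.id P)
    have hsub : Set.univ ×ˢ {ω | ∃ t < T k, g (X t ω) = k} ⊆
        E k ∪ (Prod.map (flipBit k) id) ⁻¹' (E k) := by
      rintro ⟨b, ω⟩ ⟨-, hω⟩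
      have hω' : ∃ t, t < T k ∧ g (X t ω) = k := hω
      let t := Nat.find hω'
      obtain ⟨htT, hgt⟩ : t < T k ∧ g (X t ω) = k := Nat.find_spec hω'
      have hmin : ∀ s < t, g (X s ω) ≠ k := fun s hs hgs =>
        Nat.find_min hω' hs ⟨hs.trans htT, hgs⟩
      have hpred : pred t (flipBit k b) ω = pred t b ω := by
        simp only [pred]
        congr 1
        funext s
        simp [F, flipBit, hmin s s.2]
      have h1 : F b (X t ω) = lab k (b k) := by simp only [F, hgt]
      have h2 : F (flipBit k b) (X t ω) = lab k (!b k) := by simp [F, hgt, flipBit]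
      have h3 : ℓ (y k) (y' k) ≤ max cℓ 0 * (L t b ω + L t (flipBit k b) ω) := by
        simp only [L, hpred, h1, h2]
        have h4 := hℓtri (y k) (pred t b ω) (y' k)
        have h5 : cℓ * (ℓ (pred t b ω) (y k) + ℓ (pred t b ω) (y' k)) ≤
            max cℓ 0 * (ℓ (pred t b ω) (y k) + ℓ (pred t b ω) (y' k)) :=
          mul_le_mul_of_nonneg_right (le_max_left _ _)
            (add_nonneg (hℓnonneg _ _) (hℓnonneg _ _))
        refine (h4.trans h5).trans (le_of_eq ?_)
        cases b k
        · simp [lab, add_comm]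
        · simp [lab]
      have h6 := (hy k).trans_le h3
      have h7 := lt_of_mul_lt_mul_left h6 (le_max_right _ _)
      have h8 : (k : ℝ) * (t + 1) ≤ k * T k := by
        gcongr
        exact_mod_cast htT
      by_cases h9 : (k : ℝ) * (t + 1) < L t b ω
      · exact Or.inl ⟨t, h9⟩
      · refine Or.inr ⟨t, ?_⟩
        change (k : ℝ) * (t + 1) < L t (flipBit k b) ω
        linarith
    have h1 := (measure_mono (μ := μ.prod P) hsub).trans (measure_union_le _ _)
    rw [hpres.measure_preimage (hEm k).nullMeasurableSet, Measure.prod_prod, measure_univ, one_mul,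
      ← two_mul] at h1
    exact (hhit k).trans h1
  have hlim := tendsto_measure_iInter_atTop (μ := μ.prod P)
    (fun k => (hEm k).nullMeasurableSet) hEanti ⟨0, measure_ne_top _ _⟩
  rw [hnull] at hlim
  have hlim2 : Tendsto (fun k => 2 * (μ.prod P) (E k)) atTop (nhds (2 * 0)) :=
    ENNReal.Tendsto.const_mul hlim (Or.inr (by norm_num))
  rw [mul_zero] at hlim2
  exact absurd (ge_of_tendsto' hlim2 hlow) (not_le.2 hr)

theorem aux_mem_finite {𝒳 𝒴 Ω : Type*} (ℓ : 𝒴 → 𝒴 → ℝ)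
    (hℓnonneg : ∀ y y' : 𝒴, 0 ≤ ℓ y y') (hℓrefl : ∀ y : 𝒴, ℓ y y = 0)
    (X : ℕ → Ω → 𝒳) (y₀ : 𝒴) (fstar : 𝒳 → 𝒴) (ω : Ω)
    (hfin : (Set.range fun t => X t ω).Finite) :
    Filter.limsup (fun T : ℕ => ((avgLoss ℓ (memorizationRule y₀) X fstar T ω : ℝ) : EReal))
      atTop = 0 := by
  classical
  let L : ℕ → ℝ := fun t => ℓ (memorizationRule y₀ t (fun s : Fin t => X s ω)
    (fun s : Fin t => fstar (X s ω)) (X t ω)) (fstar (X t ω))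
  have hL0 : ∀ t, 0 ≤ L t := fun t => hℓnonneg _ _
  have hLz : ∀ t, (∃ s < t, X s ω = X t ω) → L t = 0 := by
    rintro t ⟨s, hs, h⟩
    have hex : ∃ s : Fin t, X s ω = X t ω := ⟨⟨s, hs⟩, h⟩
    simp only [L, memorizationRule, dif_pos hex]
    rw [hex.choose_spec, hℓrefl]
  have hnew : {t | ∀ s < t, X s ω ≠ X t ω}.Finite := by
    refine Set.Finite.of_finite_image (f := fun t => X t ω) (hfin.subset ?_) ?_
    · rintro _ ⟨t, -, rfl⟩; exact ⟨t, rfl⟩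
    · intro a ha b hb hab
      rcases lt_trichotomy a b with h | h | h
      · exact absurd hab (hb a h)
      · exact h
      · exact absurd hab.symm (ha b h)
  have hsum : ∀ T, ∑ t ∈ range T, L t ≤ ∑ t ∈ hnew.toFinset, L t := by
    intro T
    rw [← Finset.sum_filter_ne_zero]
    refine Finset.sum_le_sum_of_subset_of_nonneg (fun t ht => ?_) fun t _ _ => hL0 t
    replace ht := (Finset.mem_filter.1 ht).2
    rw [Set.Finite.mem_toFinset]
    intro s hs h
    exact ht (hLz t ⟨s, hs, h⟩)
  have hlim : Tendsto (fun T : ℕ => avgLoss ℓ (memorizationRule y₀) X fstar T ω) atTop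
      (nhds 0) := by
    refine squeeze_zero (fun T => ?_) (fun T => ?_)
      (tendsto_const_div_atTop_nhds_zero_nat (∑ t ∈ hnew.toFinset, L t))
    · exact div_nonneg (Finset.sum_nonneg fun t _ => hL0 t) (Nat.cast_nonneg _)
    · exact div_le_div_of_nonneg_right (hsum T) (Nat.cast_nonneg _)
  exact ((continuous_coe_real_ereal.tendsto 0).comp hlim).limsup_eq

/-- **Theorem (memorization is optimistically universal).** Let `𝒳` be a separable metric space,
`𝒴` a measurable value space, and `ℓ` an unbounded measurable loss satisfying `ℓ y y = 0` and a
relaxed triangle inequality with finite constant `cℓ`. Then for every stochastic process `X`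
under which some online learning rule is strongly universally consistent, the memorization rule
is strongly universally consistent under `X`. -/
theorem memorization_optimistically_universal {𝒳 𝒴 Ω : Type*}
    [MetricSpace 𝒳] [TopologicalSpace.SeparableSpace 𝒳]
    [MeasurableSpace 𝒳] [BorelSpace 𝒳] [MeasurableSpace 𝒴]
    (ℓ : 𝒴 → 𝒴 → ℝ) (cℓ : ℝ)
    (hℓmeas : Measurable fun p : 𝒴 × 𝒴 => ℓ p.1 p.2)
    (hℓnonneg : ∀ y y' : 𝒴, 0 ≤ ℓ y y')
    (hℓrefl : ∀ y : 𝒴, ℓ y y = 0)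
    (hℓtri : ∀ y₁ y₂ y₃ : 𝒴, ℓ y₁ y₃ ≤ cℓ * (ℓ y₂ y₁ + ℓ y₂ y₃))
    (hℓunbounded : ∀ C : ℝ, ∃ y y' : 𝒴, C < ℓ y y')
    [MeasurableSpace Ω] (P : Measure Ω) [IsProbabilityMeasure P]
    (X : ℕ → Ω → 𝒳) (hX : ∀ t, Measurable (X t)) (y₀ : 𝒴)
    (hSUOL : ∃ f : (t : ℕ) → (Fin t → 𝒳) → (Fin t → 𝒴) → 𝒳 → 𝒴,
        IsOnlineLearningRule f ∧ StronglyUniversallyConsistent P ℓ f X) :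
    StronglyUniversallyConsistent P ℓ (memorizationRule y₀) X := by
  classical
  obtain ⟨f, hf, hc⟩ := hSUOL
  have : SecondCountableTopology 𝒳 := UniformSpace.secondCountable_of_separable 𝒳
  have hzero : P {ω | (Set.range fun t => X t ω).Infinite} = 0 := by
    by_contra hne
    have hδ : 0 < (P {ω | (Set.range fun t => X t ω).Infinite}).toReal :=
      ENNReal.toReal_pos hne (measure_ne_top _ _)
    obtain ⟨g, T, hg, hhit⟩ := aux_partition P X hX _ hδ
      (ENNReal.ofReal_toReal (measure_ne_top _ _)).symm
    exact aux_no_partition ℓ cℓ hℓmeas hℓnonneg hℓtri hℓunbounded P X hX f hf hc g hg T _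
      (ENNReal.ofReal_pos.2 (by positivity)) hhit
  intro fstar _
  have hae : ∀ᵐ ω ∂P, (Set.range fun t => X t ω).Finite := by
    rw [ae_iff]
    exact hzero
  filter_upwards [hae] with ω hω
  exact aux_mem_finite ℓ hℓnonneg hℓrefl X y₀ fstar ω hω

end
end

section
/- For any separable metric space 𝒳 (with its Borel σ-algebra), FMV = FS: a stochastic process 𝕏 on 𝒳 satisfies the condition that for every countable measurable partition of 𝒳 it almost surely visits only finitely many cells, if and only if 𝕏 almost surely takes only finitely many distinct values. -/
open MeasureTheory Filter

/-- Condition FMV: for every countable measurable partition of the space, the process almost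
surely visits only finitely many cells. -/
def FMV {𝒳 Ω : Type*} [MeasurableSpace 𝒳] [MeasurableSpace Ω]
    (P : Measure Ω) (X : ℕ → Ω → 𝒳) : Prop :=
  ∀ A : ℕ → Set 𝒳, (∀ k, MeasurableSet (A k)) → Pairwise (Function.onFun Disjoint A) →
    (⋃ k, A k) = Set.univ →
    ∀ᵐ ω ∂P, {k : ℕ | ∃ t, X t ω ∈ A k}.Finite

open Classical in
/-- Counting colourings that take values in `U` on `S`. -/
lemma count_colourings {K : Type*} [Fintype K] (M : ℕ) (S : Finset K) (U : Finset (Fin (M+1))) :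
    ∃ s : Finset (K → Fin (M+1)), (∀ c, c ∈ s ↔ ∀ k ∈ S, c k ∈ U) ∧
    (s.card : ℝ) = ((U.card : ℝ) / (M+1)) ^ S.card * ((Nat.card (K → Fin (M+1)) : ℕ) : ℝ) := by
  refine ⟨Finset.univ.filter (fun c : K → Fin (M+1) => ∀ k ∈ S, c k ∈ U), by simp, ?_⟩
  have h1 : Finset.univ.filter (fun c : K → Fin (M+1) => ∀ k ∈ S, c k ∈ U)
      = Fintype.piFinset (fun k => if k ∈ S then U else Finset.univ) := by
    ext c
    simp only [Finset.mem_filter, Finset.mem_univ, true_and, Fintype.mem_piFinset]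
    refine forall_congr' fun k => ?_
    by_cases hk : k ∈ S <;> simp [hk]
  have hM : (M + 1 : ℝ) ≠ 0 := by positivity
  rw [h1, Fintype.card_piFinset]
  have h2 : ∀ k : K, (((if k ∈ S then U else Finset.univ : Finset (Fin (M+1))).card : ℕ) : ℝ)
      = (if k ∈ S then ((U.card : ℝ) / (M+1)) else 1) * (M+1) := by
    intro k
    by_cases hk : k ∈ S
    · simp [hk]; field_simp
    · simp [hk]
  rw [Nat.cast_prod, Finset.prod_congr rfl (fun k _ => h2 k), Finset.prod_mul_distrib]
  simp [Finset.prod_ite_mem, div_pow, Nat.card_eq_fintype_card]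

open Classical in
lemma sum_measure_le {Ω C : Type*} [MeasurableSpace Ω] (P : Measure Ω) [IsProbabilityMeasure P]
    [Fintype C] (R : C → Set Ω) (hR : ∀ c, MeasurableSet (R c)) (b : ℝ)
    (h : ∀ ω, ∃ s : Finset C, (∀ c, ω ∈ R c → c ∈ s) ∧ (s.card : ℝ) ≤ b) :
    ∑ c, P.real (R c) ≤ b := by
  have hi : ∀ c ∈ (Finset.univ : Finset C), Integrable ((R c).indicator (1 : Ω → ℝ)) P := by
    intro c _
    exact (integrable_const (1:ℝ)).indicator (hR c)
  calc ∑ c, P.real (R c) = ∑ c, ∫ ω, (R c).indicator (1 : Ω → ℝ) ω ∂P :=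
        Finset.sum_congr rfl fun c _ => (integral_indicator_one (hR c)).symm
    _ = ∫ ω, ∑ c, (R c).indicator (1 : Ω → ℝ) ω ∂P := (integral_finsetSum _ hi).symm
    _ ≤ ∫ _ω, b ∂P := by
        refine integral_mono (integrable_finsetSum _ hi) (integrable_const b) fun ω => ?_
        obtain ⟨s, hs, hb⟩ := h ω
        have hsub : Finset.univ.filter (fun c => ω ∈ R c) ⊆ s := fun c hc =>
          hs c (Finset.mem_filter.1 hc).2
        have h3 : ((Finset.univ.filter (fun c => ω ∈ R c)).card : ℝ) ≤ b :=
          le_trans (by exact_mod_cast Finset.card_le_card hsub) hb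
        simpa [Set.indicator_apply] using h3
    _ = b := by simp

/-- Level-`m` code of a point. -/
noncomputable def cellCode {𝒳 : Type*} [MeasurableSpace 𝒳] [MeasurableSpace.CountablyGenerated 𝒳]
    (m : ℕ) (x : 𝒳) : Fin m → Bool :=
  fun i => MeasurableSpace.mapNatBool 𝒳 x i

lemma measurable_cellCode {𝒳 : Type*} [MeasurableSpace 𝒳]
    [MeasurableSpace.CountablyGenerated 𝒳] (m : ℕ) : Measurable (cellCode (𝒳 := 𝒳) m) := by
  refine measurable_pi_lambda _ fun i => ?_
  exact (measurable_pi_apply (i : ℕ)).comp (MeasurableSpace.measurable_mapNatBool 𝒳)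

lemma eventually_separated {𝒳 : Type*} [MeasurableSpace 𝒳]
    [MeasurableSpace.CountablyGenerated 𝒳] [MeasurableSpace.SeparatesPoints 𝒳] (x y : 𝒳) :
    ∀ᶠ m in atTop, cellCode m x = cellCode m y → x = y := by
  by_cases hxy : x = y
  · simp [hxy]
  · have : MeasurableSpace.mapNatBool 𝒳 x ≠ MeasurableSpace.mapNatBool 𝒳 y :=
      fun h => hxy (MeasurableSpace.injective_mapNatBool 𝒳 h)
    obtain ⟨n, hn⟩ := Function.ne_iff.1 this
    filter_upwards [eventually_gt_atTop n] with m hm h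
    exact absurd (congrFun h ⟨n, hm⟩) hn

open Classical in
/-- cells of level `m` visited before time `m`. -/
noncomputable def visited {𝒳 Ω : Type*} [MeasurableSpace 𝒳]
    [MeasurableSpace.CountablyGenerated 𝒳] (X : ℕ → Ω → 𝒳) (m : ℕ) (ω : Ω) :
    Finset (Fin m → Bool) :=
  (Finset.range m).image fun t => cellCode m (X t ω)

lemma visited_card_mono {𝒳 Ω : Type*} [MeasurableSpace 𝒳]
    [MeasurableSpace.CountablyGenerated 𝒳] (X : ℕ → Ω → 𝒳) (ω : Ω) :
    Monotone fun m => (visited X m ω).card := by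
  classical
  intro m n hmn
  have : visited X m ω ⊆ (visited X n ω).image (fun c i => c (Fin.castLE hmn i)) := by
    intro c hc
    simp only [visited, Finset.mem_image, Finset.mem_range] at hc ⊢
    obtain ⟨t, ht, rfl⟩ := hc
    exact ⟨_, ⟨t, by omega, rfl⟩, rfl⟩
  exact (Finset.card_le_card this).trans Finset.card_image_le

lemma visited_unbounded {𝒳 Ω : Type*} [MeasurableSpace 𝒳]
    [MeasurableSpace.CountablyGenerated 𝒳] [MeasurableSpace.SeparatesPoints 𝒳]
    (X : ℕ → Ω → 𝒳) (ω : Ω) (h : (Set.range fun t => X t ω).Infinite) (N : ℕ) :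
    ∃ m, N ≤ (visited X m ω).card := by
  classical
  obtain ⟨s, hs, rfl⟩ := h.exists_subset_card_eq N
  have h1 : ∀ᶠ m in atTop, ∀ x ∈ s, ∀ y ∈ s, cellCode m x = cellCode m y → x = y := by
    rw [Filter.eventually_all_finset]
    intro x _
    rw [Filter.eventually_all_finset]
    intro y _
    exact eventually_separated x y
  have h2 : ∀ᶠ m in atTop, ∀ x ∈ s, ∃ t < m, X t ω = x := by
    rw [Filter.eventually_all_finset]
    intro x hx
    obtain ⟨t, ht⟩ := hs hx
    filter_upwards [eventually_gt_atTop t] with m hm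
    exact ⟨t, hm, ht⟩
  obtain ⟨m, h1, h2⟩ := (h1.and h2).exists
  refine ⟨m, ?_⟩
  rw [← Finset.card_image_of_injOn (s := s) (f := cellCode m) (fun x hx y hy => h1 x hx y hy)]
  refine Finset.card_le_card fun c hc => ?_
  obtain ⟨x, hx, rfl⟩ := Finset.mem_image.1 hc
  obtain ⟨t, ht, rfl⟩ := h2 x hx
  exact Finset.mem_image.2 ⟨t, Finset.mem_range.2 ht, rfl⟩

lemma measurable_visited {𝒳 Ω : Type*} [MeasurableSpace 𝒳] [MeasurableSpace Ω]
    [MeasurableSpace.CountablyGenerated 𝒳] (X : ℕ → Ω → 𝒳) (hX : ∀ t, Measurable (X t)) (m : ℕ)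
    (Q : Finset (Fin m → Bool) → Prop) : MeasurableSet {ω | Q (visited X m ω)} := by
  classical
  have h : {ω | Q (visited X m ω)} = (fun ω (t : Fin m) => cellCode m (X t ω)) ⁻¹'
      {g | Q (Finset.univ.image g)} := by
    ext ω
    have : visited X m ω = Finset.univ.image (fun t : Fin m => cellCode m (X t ω)) := by
      ext c
      simp only [visited, Finset.mem_image, Finset.mem_range, Finset.mem_univ, true_and]
      exact ⟨fun ⟨t, ht, h⟩ => ⟨⟨t, ht⟩, h⟩, fun ⟨t, h⟩ => ⟨t, t.2, h⟩⟩
    simp [this]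
  rw [h]
  have hm : Measurable (fun ω (t : Fin m) => cellCode m (X t ω)) :=
    measurable_pi_lambda _ fun t => (measurable_cellCode m).comp (hX t)
  exact hm (Set.toFinite _).measurableSet

lemma exists_level {𝒳 Ω : Type*} [MeasurableSpace 𝒳] [MeasurableSpace Ω]
    [MeasurableSpace.CountablyGenerated 𝒳] [MeasurableSpace.SeparatesPoints 𝒳]
    (P : Measure Ω) [IsProbabilityMeasure P]
    (X : ℕ → Ω → 𝒳) (hX : ∀ t, Measurable (X t)) (T N : ℕ) (ε : ℝ) (hε : 0 < ε) :
    ∃ m, T ≤ m ∧ P.real ({ω | (Set.range fun t => X t ω).Infinite} \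
      {ω | N ≤ (visited X m ω).card}) ≤ ε := by
  set F : ℕ → Set Ω := fun m => {ω | N ≤ (visited X m ω).card} with hF
  have hFm : ∀ m, MeasurableSet (F m) := fun m => measurable_visited X hX m (fun s => N ≤ s.card)
  have hmono : Monotone F := fun m n hmn ω (h : N ≤ _) => h.trans (visited_card_mono X ω hmn)
  have ht : Tendsto (fun m => P.real ((⋃ n, F n) \ F m)) atTop (nhds 0) := by
    have h1 : Tendsto (fun m => P.real (F m)) atTop (nhds (P.real (⋃ n, F n))) :=
      (ENNReal.tendsto_toReal (measure_ne_top _ _)).comp (tendsto_measure_iUnion_atTop hmono)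
    have h2 := (tendsto_const_nhds (x := P.real (⋃ n, F n))).sub h1
    rw [sub_self] at h2
    refine h2.congr fun m => ?_
    rw [measureReal_sdiff (Set.subset_iUnion F m) (hFm m)]
  obtain ⟨m, h1, h2⟩ := ((ht.eventually (gt_mem_nhds hε)).and (eventually_ge_atTop T)).exists
  refine ⟨m, h2, (measureReal_mono ?_).trans h1.le⟩
  refine Set.sdiff_subset_sdiff_left fun ω hω => ?_
  obtain ⟨n, hn⟩ := visited_unbounded X ω hω N
  exact Set.mem_iUnion.2 ⟨n, hn⟩

lemma exists_hitting {𝒳 Ω : Type*} [MeasurableSpace 𝒳] [MeasurableSpace Ω]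
    [MeasurableSpace.CountablyGenerated 𝒳] [MeasurableSpace.SeparatesPoints 𝒳]
    (P : Measure Ω) [IsProbabilityMeasure P]
    (X : ℕ → Ω → 𝒳) (hX : ∀ t, Measurable (X t)) (T : ℕ) (ε : ℝ) (hε : 0 < ε) :
    ∃ (B : Set 𝒳) (m : ℕ), MeasurableSet B ∧ T ≤ m ∧
      P.real {ω | ∃ t < T, X t ω ∈ B} ≤ ε ∧
      P.real {ω | (Set.range fun t => X t ω).Infinite ∧ ∀ t < m, X t ω ∉ B} ≤ ε := by
  classical
  have hε3 : 0 < ε / 3 := by positivity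
  obtain ⟨M, hM⟩ : ∃ M : ℕ, (T : ℝ) * (1 / (M + 1)) ≤ ε / 3 := by
    obtain ⟨M, hM⟩ := exists_nat_gt (T / (ε / 3))
    refine ⟨M, ?_⟩
    rw [div_lt_iff₀ hε3] at hM
    rw [mul_one_div, div_le_iff₀ (by positivity)]
    nlinarith
  obtain ⟨N, hN⟩ : ∃ N : ℕ, ((M : ℝ) / (M + 1)) ^ N < ε / 3 :=
    exists_pow_lt_of_lt_one hε3 (by rw [div_lt_one (by positivity)]; linarith)
  obtain ⟨m, hTm, hm⟩ := exists_level P X hX T N (ε/3) hε3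
  set K := Fin m → Bool
  set C := K → Fin (M+1)
  let B : C → Set 𝒳 := fun c => {x | c (cellCode m x) = 0}
  have hB : ∀ c, MeasurableSet (B c) := fun c =>
    (measurable_cellCode m) (Set.toFinite {k | c k = 0}).measurableSet
  let R1 : C → Set Ω := fun c => {ω | ∃ t < T, X t ω ∈ B c}
  let R2 : C → Set Ω := fun c => {ω | N ≤ (visited X m ω).card ∧ ∀ k ∈ visited X m ω, c k ≠ 0}
  have hR1 : ∀ c, MeasurableSet (R1 c) := by
    intro c
    have : R1 c = ⋃ t ∈ Finset.range T, X t ⁻¹' B c := by ext ω; simp [R1]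
    rw [this]
    exact Finset.measurableSet_biUnion _ fun t _ => hX t (hB c)
  have hR2 : ∀ c, MeasurableSet (R2 c) := fun c =>
    measurable_visited X hX m (fun s => N ≤ s.card ∧ ∀ k ∈ s, c k ≠ 0)
  have s1 : ∑ c, P.real (R1 c) ≤ (ε/3) * (Nat.card C : ℝ) := by
    refine sum_measure_le P R1 hR1 _ fun ω => ?_
    choose s hs hcard using fun t => count_colourings (K := K) M {cellCode m (X t ω)} {0}
    refine ⟨(Finset.range T).biUnion s, ?_, ?_⟩
    · rintro c ⟨t, ht, hc⟩
      refine Finset.mem_biUnion.2 ⟨t, Finset.mem_range.2 ht, (hs t c).2 ?_⟩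
      simpa [B] using hc
    have h2 : (((Finset.range T).biUnion s).card : ℝ) ≤
        ∑ t ∈ Finset.range T, ((s t).card : ℝ) := by
      exact_mod_cast Finset.card_biUnion_le
    refine h2.trans ?_
    rw [Finset.sum_congr rfl (fun t _ => hcard t)]
    simp only [Finset.card_singleton, pow_one, Finset.sum_const, Finset.card_range, nsmul_eq_mul,
      Nat.cast_one]
    rw [← mul_assoc]
    exact mul_le_mul_of_nonneg_right hM (Nat.cast_nonneg _)
  have s2 : ∑ c, P.real (R2 c) ≤ (ε/3) * (Nat.card C : ℝ) := by
    refine sum_measure_le P R2 hR2 _ fun ω => ?_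
    by_cases hω : N ≤ (visited X m ω).card
    · obtain ⟨s, hs, hcard⟩ := count_colourings (K := K) M (visited X m ω) (Finset.univ.erase 0)
      refine ⟨s, fun c hc => (hs c).2 fun k hk => by simpa using hc.2 k hk, ?_⟩
      rw [hcard]
      refine mul_le_mul_of_nonneg_right ?_ (Nat.cast_nonneg _)
      have : ((Finset.univ.erase 0 : Finset (Fin (M+1))).card : ℝ) = M := by simp
      rw [this]
      refine (pow_le_pow_of_le_one (by positivity) ?_ hω).trans hN.le
      rw [div_le_one (by positivity)]; linarith
    · refine ⟨∅, fun c hc => absurd hc.1 hω, ?_⟩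
      simp only [Finset.card_empty, Nat.cast_zero]
      positivity
  have hs : ∑ c : C, (P.real (R1 c) + P.real (R2 c)) ≤ ∑ _c : C, (2 * ε / 3) := by
    rw [Finset.sum_add_distrib]
    simp only [Finset.sum_const, nsmul_eq_mul, Finset.card_univ, ← Nat.card_eq_fintype_card]
    linarith
  obtain ⟨c, -, hc⟩ := Finset.exists_le_of_sum_le Finset.univ_nonempty hs
  have p1 : 0 ≤ P.real (R1 c) := measureReal_nonneg
  have p2 : 0 ≤ P.real (R2 c) := measureReal_nonneg
  refine ⟨B c, m, hB c, hTm, ?_, ?_⟩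
  · change P.real (R1 c) ≤ ε
    linarith
  · have hsub : {ω | (Set.range fun t => X t ω).Infinite ∧ ∀ t < m, X t ω ∉ B c} ⊆
        ({ω | (Set.range fun t => X t ω).Infinite} \ {ω | N ≤ (visited X m ω).card}) ∪ R2 c := by
      rintro ω ⟨h1, h2⟩
      by_cases hω : N ≤ (visited X m ω).card
      · right
        refine ⟨hω, fun k hk => ?_⟩
        simp only [visited, Finset.mem_image, Finset.mem_range] at hk
        obtain ⟨t, ht, rfl⟩ := hk
        exact h2 t ht
      · left
        exact ⟨h1, hω⟩
    have := (measureReal_mono (μ := P) hsub).trans (measureReal_union_le _ _)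
    linarith

lemma fs_of_fmv {𝒳 Ω : Type*} [MeasurableSpace 𝒳] [MeasurableSpace Ω]
    [MeasurableSpace.CountablyGenerated 𝒳] [MeasurableSpace.SeparatesPoints 𝒳]
    (P : Measure Ω) [IsProbabilityMeasure P]
    (X : ℕ → Ω → 𝒳) (hX : ∀ t, Measurable (X t)) (h : FMV P X) : FS P X := by
  choose B' T' hB' hT' h1' h2' using fun (T k : ℕ) =>
    exists_hitting P X hX T ((1/2 : ℝ) ^ k) (by positivity)
  let T : ℕ → ℕ := fun k => Nat.rec 0 (fun k T => T' T k) k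
  have hTs : ∀ k, T (k+1) = T' (T k) k := fun k => rfl
  have hTm : Monotone T := monotone_nat_of_le_succ fun k => hT' _ _
  let B : ℕ → Set 𝒳 := fun k => B' (T k) k
  have hB : ∀ k, MeasurableSet (B k) := fun k => hB' _ _
  have bc : ∀ S : ℕ → Set Ω, (∀ k, P.real (S k) ≤ (1/2 : ℝ)^k) →
      ∀ᵐ ω ∂P, ∀ᶠ k in atTop, ω ∉ S k := by
    intro S hS
    refine ae_eventually_notMem ?_
    have hle : ∀ k, P (S k) ≤ ENNReal.ofReal ((1/2 : ℝ)^k) := fun k =>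
      (ENNReal.le_ofReal_iff_toReal_le (measure_ne_top _ _) (by positivity)).2 (hS k)
    refine ne_top_of_le_ne_top ?_ (ENNReal.tsum_le_tsum hle)
    exact (summable_geometric_two).tsum_ofReal_ne_top
  have b1 := bc _ (fun k => h1' (T k) k)
  have b2 := bc _ (fun k => h2' (T k) k)
  let A : ℕ → Set 𝒳 := fun k => B k \ ⋃ j ∈ Set.Ioi k, B j
  have hA : ∀ k, MeasurableSet (A k) := fun k =>
    (hB k).diff (MeasurableSet.biUnion (Set.to_countable _) fun j _ => hB j)
  have hlt : ∀ i j, i < j → Disjoint (A i) (A j) := by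
    intro i j hij
    rw [Set.disjoint_left]
    intro x hx hx'
    exact hx.2 (Set.mem_biUnion (Set.mem_Ioi.2 hij) hx'.1)
  have hAd : ∀ i j, i ≠ j → Disjoint (A i) (A j) := by
    intro i j hij
    rcases lt_or_gt_of_ne hij with h | h
    · exact hlt _ _ h
    · exact (hlt _ _ h).symm
  let A' : ℕ → Set 𝒳 := fun k => Nat.casesOn k (⋃ k, A k)ᶜ A
  have hfin := h A' (by
      rintro (_ | k)
      · exact (MeasurableSet.iUnion hA).compl
      · exact hA k)
    (by
      rintro (_ | i) (_ | j) hij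
      · exact absurd rfl hij
      · exact (Set.disjoint_compl_left_iff_subset.2 (Set.subset_iUnion A j))
      · exact (Set.disjoint_compl_left_iff_subset.2 (Set.subset_iUnion A i)).symm
      · exact hAd i j (by omega))
    (by
      rw [Set.eq_univ_iff_forall]
      intro x
      by_cases hx : x ∈ ⋃ k, A k
      · obtain ⟨k, hk⟩ := Set.mem_iUnion.1 hx
        exact Set.mem_iUnion.2 ⟨k+1, hk⟩
      · exact Set.mem_iUnion.2 ⟨0, hx⟩)
  filter_upwards [b1, b2, hfin] with ω e1 e2 hf
  by_contra hinf
  obtain ⟨n, hn⟩ := Filter.eventually_atTop.1 (e1.and e2)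
  refine (Set.infinite_of_injective_forall_mem (f := fun i : ℕ => n + i + 1)
    (fun a b hab => by simpa using hab) (fun i => ?_)) hf
  have hk := (hn (n+i) (by omega)).2
  simp only [Set.mem_setOf_eq, not_and, not_forall, not_not] at hk
  obtain ⟨t, ht, hxt⟩ := hk hinf
  refine ⟨t, hxt, ?_⟩
  simp only [Set.mem_iUnion, not_exists]
  intro j hj hxj
  have hj' : n + i < j := hj
  refine (hn j (by omega)).1 ⟨t, lt_of_lt_of_le ht ?_, hxj⟩
  rw [← hTs]
  exact hTm hj'

/-- **Theorem (FMV = FS).** For any separable metric space `𝒳` (with its Borel σ-algebra), a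
stochastic process `X` on `𝒳` visits only finitely many cells of every countable measurable
partition almost surely if and only if it almost surely takes only finitely many distinct
values. -/
theorem fmv_eq_fs {𝒳 Ω : Type*} [MetricSpace 𝒳] [TopologicalSpace.SeparableSpace 𝒳]
    [MeasurableSpace 𝒳] [BorelSpace 𝒳]
    [MeasurableSpace Ω] (P : Measure Ω) [IsProbabilityMeasure P]
    (X : ℕ → Ω → 𝒳) (hX : ∀ t, Measurable (X t)) :
    FMV P X ↔ FS P X := by
  constructor
  · haveI : SecondCountableTopology 𝒳 := UniformSpace.secondCountable_of_separable 𝒳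
    exact fs_of_fmv P X hX
  · intro h A _ hd _
    filter_upwards [h] with ω hω
    refine (hω.biUnion (t := fun x => {k | x ∈ A k}) fun x _ => ?_).subset ?_
    · refine Set.Subsingleton.finite fun i hi j hj => ?_
      by_contra hij
      exact Set.disjoint_left.1 (hd hij) hi hj
    · rintro k ⟨t, ht⟩
      exact Set.mem_biUnion (Set.mem_range_self t) ht
end

section
/- FS ⊂ SUOL: if a stochastic process 𝕏 on a separable metric space 𝒳 almost surely takes only finitely many distinct values, then the memorization rule is strongly universally consistent under 𝕏; in particular 𝕏 admits a strongly universally consistent online learning rule. -/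
open MeasureTheory Filter Finset

noncomputable section

/-- If the point has been seen before, the memorization rule is correct. -/
theorem memorizationRule_of_seen {𝒳 𝒴 : Type*} (y₀ : 𝒴) (fstar : 𝒳 → 𝒴) (t : ℕ)
    (xs : Fin t → 𝒳) (x : 𝒳) (h : ∃ s : Fin t, xs s = x) :
    memorizationRule y₀ t xs (fun s => fstar (xs s)) x = fstar x := by
  unfold memorizationRule
  rw [dif_pos h]
  exact congrArg fstar h.choose_spec

open Classical in
theorem memorizationRule_measurable {𝒳 𝒴 : Type*}
    [MetricSpace 𝒳] [TopologicalSpace.SeparableSpace 𝒳]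
    [MeasurableSpace 𝒳] [BorelSpace 𝒳] [MeasurableSpace 𝒴] (y₀ : 𝒴) :
    IsOnlineLearningRule (memorizationRule (𝒳 := 𝒳) y₀) := by
  intro t
  have : SecondCountableTopology 𝒳 := UniformSpace.secondCountable_of_separable 𝒳
  let G : (Fin t → 𝒴) × (Fin t → Prop) → 𝒴 := fun q =>
    if h : ∃ s : Fin t, q.2 s then q.1 h.choose else y₀
  have hG : Measurable G := by
    apply measurable_from_prod_countable_left
    intro S
    by_cases h : ∃ s : Fin t, S s
    · have : (fun x : Fin t → 𝒴 => G (x, S)) = fun x => x h.choose := by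
        funext x
        exact dif_pos h
      rw [this]
      exact measurable_pi_apply _
    · have : (fun x : Fin t → 𝒴 => G (x, S)) = fun x => y₀ := by
        funext x
        exact dif_neg h
      rw [this]
      exact measurable_const
  have hS : Measurable fun p : (Fin t → 𝒳) × (Fin t → 𝒴) × 𝒳 =>
      (p.2.1, fun s : Fin t => p.1 s = p.2.2) := by
    refine Measurable.prodMk (by fun_prop) ?_
    refine measurable_pi_lambda _ fun s => ?_
    apply measurableSet_setOfPred.mp
    exact measurableSet_eq_fun (by fun_prop) (by fun_prop)
  exact hG.comp hS

/-- **Theorem (FS ⊆ SUOL).** If a stochastic process `X` on a separable metric space `𝒳` almost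
surely takes only finitely many distinct values, then the memorization rule is strongly
universally consistent under `X`; in particular, `X` admits a strongly universally consistent
online learning rule. -/
theorem fs_subset_suol {𝒳 𝒴 Ω : Type*}
    [MetricSpace 𝒳] [TopologicalSpace.SeparableSpace 𝒳]
    [MeasurableSpace 𝒳] [BorelSpace 𝒳] [MeasurableSpace 𝒴]
    (ℓ : 𝒴 → 𝒴 → ℝ)
    (hℓmeas : Measurable fun p : 𝒴 × 𝒴 => ℓ p.1 p.2)
    (hℓnonneg : ∀ y y' : 𝒴, 0 ≤ ℓ y y')
    (hℓrefl : ∀ y : 𝒴, ℓ y y = 0)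
    [MeasurableSpace Ω] (P : Measure Ω) [IsProbabilityMeasure P]
    (X : ℕ → Ω → 𝒳) (hX : ∀ t, Measurable (X t)) (y₀ : 𝒴)
    (hFS : FS P X) :
    StronglyUniversallyConsistent P ℓ (memorizationRule y₀) X ∧
      ∃ f : (t : ℕ) → (Fin t → 𝒳) → (Fin t → 𝒴) → 𝒳 → 𝒴,
        IsOnlineLearningRule f ∧ StronglyUniversallyConsistent P ℓ f X := by
  have main : StronglyUniversallyConsistent P ℓ (memorizationRule y₀) X := by
    intro fstar _
    filter_upwards [hFS] with ω hω
    -- all values appear before some time `N`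
    obtain ⟨N, hN⟩ : ∃ N : ℕ, ∀ t, ∃ s < N, X s ω = X t ω := by
      have hc : ∀ x : Set.range fun t => X t ω, ∃ s, X s ω = x := fun x => x.2
      choose g hg using hc
      have := hω.to_subtype
      obtain ⟨M, hM⟩ := (Set.finite_range g).bddAbove
      exact ⟨M + 1, fun t => ⟨g ⟨X t ω, t, rfl⟩,
        Nat.lt_succ_of_le (hM ⟨_, rfl⟩), hg _⟩⟩
    have hz : ∀ t ≥ N, ℓ (memorizationRule y₀ t (fun s : Fin t => X s ω)
        (fun s : Fin t => fstar (X s ω)) (X t ω)) (fstar (X t ω)) = 0 := by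
      intro t ht
      obtain ⟨s, hs, hst⟩ := hN t
      rw [memorizationRule_of_seen y₀ fstar t (fun s : Fin t => X s ω) (X t ω)
        ⟨⟨s, lt_of_lt_of_le hs ht⟩, hst⟩]
      exact hℓrefl _
    have hlim : Tendsto (fun T : ℕ => avgLoss ℓ (memorizationRule y₀) X fstar T ω) atTop
        (nhds 0) := by
      refine (tendsto_const_div_atTop_nhds_zero_nat (∑ t ∈ Finset.range N,
        ℓ (memorizationRule y₀ t (fun s : Fin t => X s ω)
        (fun s : Fin t => fstar (X s ω)) (X t ω)) (fstar (X t ω)))).congr' ?_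
      filter_upwards [eventually_ge_atTop N] with T hT
      unfold avgLoss
      rw [Finset.eventually_constant_sum hz hT]
    have hE := (continuous_coe_real_ereal.tendsto (0 : ℝ)).comp hlim
    exact hE.limsup_eq
  exact ⟨main, memorizationRule y₀, memorizationRule_measurable y₀, main⟩

end
end

section
/- If the separable metric space 𝒳 is infinite, then there is no consistent hypothesis test for condition FS: for every sequence of (possibly randomized) decision functions t̂_n taking the first n points of a process as input and outputting a value in {0,1}, there exists a (deterministic) process 𝕏 in 𝒳 such that t̂_n(X_1,…,X_n) does not converge in probability to the indicator 1_{𝕏 ∈ FS}. -/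
open MeasureTheory Filter

open Classical in
/-- **Theorem (no consistent hypothesis test for FS).** If the separable metric space `𝒳` is
infinite, then for every (possibly randomized, `{0,1}`-valued) sequence of measurable decision
functions `test n : 𝒳ⁿ × Ω' → ℝ`, there exists a deterministic process `x : ℕ → 𝒳` such that
`test n (x₁,…,xₙ)` does not converge in probability to the indicator of the event that `x`
takes only finitely many distinct values (condition FS). -/
theorem no_consistent_test_fs {𝒳 : Type*} [MetricSpace 𝒳] [TopologicalSpace.SeparableSpace 𝒳]
    [MeasurableSpace 𝒳] [BorelSpace 𝒳] [Infinite 𝒳]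
    {Ω' : Type*} [MeasurableSpace Ω'] (P' : Measure Ω') [IsProbabilityMeasure P']
    (test : (n : ℕ) → (Fin n → 𝒳) → Ω' → ℝ)
    (htestmeas : ∀ n, Measurable fun p : (Fin n → 𝒳) × Ω' => test n p.1 p.2)
    (htestvals : ∀ n xs ω', test n xs ω' = 0 ∨ test n xs ω' = 1) :
    ∃ x : ℕ → 𝒳,
      ¬ (∀ ε : ℝ, 0 < ε →
          Tendsto (fun n : ℕ =>
              P' {ω' | ε ≤ |test n (fun i : Fin n => x i) ω' -
                    (if (Set.range x).Finite then (1 : ℝ) else 0)|})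
            atTop (nhds 0)) := by
  by_contra hcon
  push Not at hcon
  obtain ⟨a⟩ : Nonempty (ℕ ↪ 𝒳) := ⟨Infinite.natEmbedding 𝒳⟩
  have h1 : ∀ (y : ℕ → 𝒳) (N : ℕ), ∃ m, N < m ∧ ((Set.range y).Finite →
      P' {ω' | (1/2 : ℝ) ≤ |test m (fun i : Fin m => y i) ω' - 1|} < 1/2) := by
    intro y N
    by_cases hy : (Set.range y).Finite
    · have h := hcon y (1/2) (by norm_num)
      simp only [if_pos hy] at h
      have h2 := h.eventually (gt_mem_nhds (show (0 : ENNReal) < 1/2 by simp))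
      obtain ⟨m, hm, hm'⟩ := (h2.and (eventually_gt_atTop N)).exists
      exact ⟨m, hm', fun _ => hm⟩
    · exact ⟨N + 1, Nat.lt_succ_self N, fun h => absurd h hy⟩
  choose M hM hP using h1
  let Y : ℕ → (ℕ → 𝒳) × ℕ := fun k => Nat.rec (fun _ => a 0, 0)
    (fun k s => (fun i => if i < M s.1 s.2 then s.1 i else a (k + 1), M s.1 s.2)) k
  have hYs : ∀ k i, (Y (k+1)).1 i = if i < (Y (k+1)).2 then (Y k).1 i else a (k + 1) :=
    fun k i => rfl
  have hN : ∀ k, (Y (k+1)).2 = M (Y k).1 (Y k).2 := fun k => rfl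
  have hfin : ∀ k, (Set.range (Y k).1).Finite := by
    intro k
    induction k with
    | zero => exact (Set.finite_singleton (a 0)).subset (by rintro _ ⟨i, rfl⟩; rfl)
    | succ k ih =>
      refine (ih.union (Set.finite_singleton (a (k+1)))).subset ?_
      rintro _ ⟨i, rfl⟩
      rw [hYs]
      split_ifs
      · exact Or.inl ⟨i, rfl⟩
      · exact Or.inr rfl
  have hmono : StrictMono fun k => (Y k).2 :=
    strictMono_nat_of_lt_succ fun k => by rw [hN]; exact hM _ _
  have hagree : ∀ i k j, k ≤ j → i < (Y (k+1)).2 → (Y j).1 i = (Y k).1 i := by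
    intro i k j hkj hi
    induction j, hkj using Nat.le_induction with
    | base => rfl
    | succ j hj ih =>
      rw [hYs, if_pos, ih]
      exact lt_of_lt_of_le hi (hmono.monotone (Nat.succ_le_succ hj))
  let x : ℕ → 𝒳 := fun i => (Y i).1 i
  have hx : ∀ k i, i < (Y (k+1)).2 → x i = (Y k).1 i := by
    intro k i hi
    rcases le_total k i with h | h
    · exact hagree i k i h hi
    · exact (hagree i i k h (lt_of_lt_of_le (Nat.lt_succ_self i) (hmono.le_apply))).symm
  have hinf : ¬ (Set.range x).Finite := by
    have : Set.range (fun k => a (k+1)) ⊆ Set.range x := by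
      rintro _ ⟨k, rfl⟩
      refine ⟨(Y (k+1)).2, ?_⟩
      rw [hx (k+1) _ (hmono (Nat.lt_succ_self (k+1))), hYs, if_neg (lt_irrefl _)]
    intro hf
    refine Set.infinite_range_of_injective (f := fun k => a (k+1)) ?_ (hf.subset this)
    intro p q h
    exact Nat.succ_injective (a.injective h)
  have h := hcon x (1/2) (by norm_num)
  simp only [if_neg hinf] at h
  have h2 := h.eventually (gt_mem_nhds (show (0 : ENNReal) < 1/2 by simp))
  have h3 : Tendsto (fun k => (Y (k+1)).2) atTop atTop :=
    hmono.tendsto_atTop.comp (tendsto_add_atTop_nat 1)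
  obtain ⟨k, hk⟩ := (h3.eventually h2).exists
  have hk' := hP (Y k).1 (Y k).2 (hfin k)
  rw [← hN] at hk'
  have he : (fun i : Fin (Y (k+1)).2 => x i) = fun i : Fin (Y (k+1)).2 => (Y k).1 i := by
    funext i
    exact hx k i i.2
  rw [← he] at hk'
  generalize (Y (k+1)).2 = n at hk hk'
  have hcov : (Set.univ : Set Ω') ⊆
      {ω' | (1/2 : ℝ) ≤ |test n (fun i : Fin n => x i) ω' - 0|} ∪
      {ω' | (1/2 : ℝ) ≤ |test n (fun i : Fin n => x i) ω' - 1|} := by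
    intro ω _
    rcases htestvals n (fun i : Fin n => x i) ω with h | h
    · right; simp only [Set.mem_setOf_eq, h]; norm_num
    · left; simp only [Set.mem_setOf_eq, h]; norm_num
  have h4 := (measure_mono hcov).trans (measure_union_le (μ := P') _ _)
  rw [measure_univ] at h4
  have h5 := lt_of_le_of_lt h4 (ENNReal.add_lt_add hk hk')
  rw [ENNReal.add_halves] at h5
  exact lt_irrefl _ h5
end

section
/- Let 𝒳 = [0,1] with its usual metric and Borel σ-algebra. Then FMV = FS: a stochastic process 𝕏 on [0,1] satisfies the condition that for every countable measurable partition of [0,1] it almost surely visits only finitely many cells, if and only if 𝕏 almost surely takes only finitely many distinct values. -/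
open MeasureTheory Filter

lemma cnt {ι : Type*} [Fintype ι] [DecidableEq ι] (M : ℕ) (W : Finset ι) :
    (Finset.univ.filter (fun f : ι → Fin (M+1) => ∀ i ∈ W, f i ≠ 0)).card * (M+1)^W.card
      = M^W.card * (M+1)^(Fintype.card ι) := by
  have h : Finset.univ.filter (fun f : ι → Fin (M+1) => ∀ i ∈ W, f i ≠ 0)
      = Fintype.piFinset (fun i => if i ∈ W then (Finset.univ.erase 0) else Finset.univ) := by
    ext f
    simp only [Finset.mem_filter, Finset.mem_univ, true_and, Fintype.mem_piFinset]
    refine forall_congr' fun i => ?_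
    split_ifs with hi <;> simp [hi]
  rw [h, Fintype.card_piFinset]
  have h2 : ∀ i, (if i ∈ W then (Finset.univ.erase (0 : Fin (M+1))) else Finset.univ).card
      = if i ∈ W then M else M+1 := by
    intro i; split_ifs <;> simp
  simp only [h2]
  rw [Finset.prod_ite]
  simp only [Finset.prod_const, Finset.filter_mem_eq_inter, Finset.univ_inter]
  have h3 : (Finset.univ.filter (fun i => i ∉ W)) = Wᶜ := by ext; simp
  rw [h3, mul_assoc, ← pow_add, Finset.card_compl, Nat.sub_add_cancel (Finset.card_le_univ W)]

lemma cnt_one {ι : Type*} [Fintype ι] [DecidableEq ι] (M : ℕ) (i : ι) :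
    (Finset.univ.filter (fun f : ι → Fin (M+1) => f i = 0)).card * (M+1)
      = (M+1)^(Fintype.card ι) := by
  have h := cnt M {i}
  have h2 := Finset.card_filter_add_card_filter_not (s := (Finset.univ : Finset (ι → Fin (M+1)))) (fun f => f i = 0)
  simp at h h2
  simp only [← ne_eq] at h2
  nlinarith

lemma cnt_hit {ι : Type*} [Fintype ι] [DecidableEq ι] (M n : ℕ) (hn : 2 * M^n ≤ (M+1)^n)
    (W : Finset ι) (hW : n ≤ W.card) :
    (M+1)^(Fintype.card ι) ≤
    2 * (Finset.univ.filter (fun f : ι → Fin (M+1) => ∃ i ∈ W, f i = 0)).card  := by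
  obtain ⟨V, hV, rfl⟩ := Finset.exists_subset_card_eq hW
  have h := cnt M V
  have h2 := Finset.card_filter_add_card_filter_not (s := (Finset.univ : Finset (ι → Fin (M+1)))) (fun f => ∀ i ∈ V, f i ≠ 0)
  have h3 : (Finset.univ.filter (fun f : ι → Fin (M+1) => ¬ ∀ i ∈ V, f i ≠ 0)).card ≤
     (Finset.univ.filter (fun f : ι → Fin (M+1) => ∃ i ∈ W, f i = 0)).card := by
    apply Finset.card_le_card
    intro f
    simp only [Finset.mem_filter, Finset.mem_univ, true_and]
    push Not
    rintro ⟨i, hi, h⟩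
    exact ⟨i, hV hi, h⟩
  simp only [Finset.card_univ, Fintype.card_fun, Fintype.card_fin] at h2
  set a := (Finset.univ.filter (fun f : ι → Fin (M+1) => ∀ i ∈ V, f i ≠ 0)).card
  have : 2 * a ≤ (M+1)^(Fintype.card ι) := by
    have hp : 0 < (M+1)^V.card := by positivity
    refine Nat.le_of_mul_le_mul_right ?_ hp
    nlinarith [Nat.mul_le_mul_right ((M+1)^(Fintype.card ι)) hn]
  omega

lemma bern (M n : ℕ) : M^(n+1) + (n+1) * M^n ≤ (M+1)^(n+1) := by
  induction n with
  | zero => simp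
  | succ n ih =>
    have := Nat.mul_le_mul_right (M+1) ih
    rw [← pow_succ] at this
    refine le_trans ?_ this
    have : 0 ≤ M^n * (n+1) := by positivity
    ring_nf at *
    nlinarith

lemma ex_n (M : ℕ) : ∃ n, 2 * M^n ≤ (M+1)^n := by
  refine ⟨M+1, le_trans ?_ (bern M M)⟩
  have : 0 ≤ M^M := by positivity
  rw [pow_succ]
  nlinarith

open scoped ENNReal

lemma sel {𝒳 Ω ι : Type*} [MeasurableSpace 𝒳] [MeasurableSpace Ω] [Fintype ι] [DecidableEq ι]
    [MeasurableSpace ι] [MeasurableSingletonClass ι]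
    (P : Measure Ω) (μ : Measure 𝒳) [IsProbabilityMeasure μ]
    (X : ℕ → Ω → 𝒳) (hX : ∀ t, Measurable (X t)) (g : 𝒳 → ι) (hg : Measurable g)
    (M n : ℕ) (hn : 2 * M^n ≤ (M+1)^n) (E : Set Ω)
    (hE : ∀ ω ∈ E, ∃ W : Finset ι, n ≤ W.card ∧ ∀ i ∈ W, ∃ t, g (X t ω) = i) :
    ∃ A : Set 𝒳, MeasurableSet A ∧
      P E + P E * ((M + 1 : ℕ) : ℝ≥0∞) * μ A ≤ 4 * P {ω | ∃ t, X t ω ∈ A} := by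
  classical
  let A : (ι → Fin (M+1)) → Set 𝒳 := fun f => {x | f (g x) = 0}
  have hA : ∀ f, MeasurableSet (A f) := fun f =>
    hg (Set.toFinite {i | f i = 0}).measurableSet
  let H : (ι → Fin (M+1)) → Set Ω := fun f => {ω | ∃ t, X t ω ∈ A f}
  have hH : ∀ f, MeasurableSet (H f) := fun f => by
    have : H f = ⋃ t, X t ⁻¹' (A f) := by ext; simp [H]
    rw [this]
    exact MeasurableSet.iUnion fun t => hX t (hA f)
  set Q : ℕ := (M+1)^(Fintype.card ι) with hQ
  have h1 : (∑ f, μ (A f)) * ((M+1 : ℕ) : ℝ≥0∞) = Q := by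
    have : ∑ f, μ (A f) = ∫⁻ x, ∑ f, (A f).indicator 1 x ∂μ := by
      rw [lintegral_finsetSum _ (fun f _ => measurable_one.indicator (hA f))]
      exact Finset.sum_congr rfl fun f _ => (lintegral_indicator_one (hA f)).symm
    rw [this, ← lintegral_mul_const' _ _ (by simp)]
    have : ∀ x, (∑ f, (A f).indicator (1 : 𝒳 → ℝ≥0∞) x) * ((M+1 : ℕ) : ℝ≥0∞) = Q := by
      intro x
      have := cnt_one M (g x)
      rw [hQ, ← this, Nat.cast_mul]
      congr 1
      simp [Set.indicator_apply, A]
    simp only [this]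
    simp
  have h2 : (Q : ℝ≥0∞) * P E ≤ 2 * ∑ f, P (H f) := by
    have : ∑ f, P (H f) = ∫⁻ x, ∑ f, (H f).indicator 1 x ∂P := by
      rw [lintegral_finsetSum _ (fun f _ => measurable_one.indicator (hH f))]
      exact Finset.sum_congr rfl fun f _ => (lintegral_indicator_one (hH f)).symm
    rw [this, ← lintegral_const_mul' _ _ (by simp)]
    refine le_trans ?_ (mul_meas_ge_le_lintegral (Measurable.const_mul (Finset.measurable_sum _ fun f _ => measurable_one.indicator (hH f)) _) (Q : ℝ≥0∞))
    gcongr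
    intro ω hω
    obtain ⟨W, hW, hW2⟩ := hE ω hω
    have h3 := cnt_hit M n hn W hW
    have h4 : (∑ f, (H f).indicator (1 : Ω → ℝ≥0∞) ω) = ((Finset.univ.filter (fun f => ω ∈ H f)).card : ℕ) := by
      simp [Set.indicator_apply]
    simp only [Set.mem_ofPred_eq]
    rw [h4]
    have h5 : (Finset.univ.filter (fun f : ι → Fin (M+1) => ∃ i ∈ W, f i = 0)).card ≤ (Finset.univ.filter (fun f => ω ∈ H f)).card := by
      apply Finset.card_le_card
      intro f
      simp only [Finset.mem_filter, Finset.mem_univ, true_and]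
      rintro ⟨i, hi, h⟩
      obtain ⟨t, rfl⟩ := hW2 i hi
      exact ⟨t, h⟩
    have h6 : Q ≤ 2 * (Finset.univ.filter (fun f => ω ∈ H f)).card := by omega
    exact_mod_cast h6
  have h3 : ∑ f, (P E + P E * ((M + 1 : ℕ) : ℝ≥0∞) * μ (A f)) ≤ ∑ f, 4 * P (H f) := by
    rw [Finset.sum_add_distrib, ← Finset.mul_sum, ← Finset.mul_sum, mul_assoc, mul_comm _ (∑ f, μ (A f)), h1]
    simp only [Finset.sum_const, Finset.card_univ, Fintype.card_fun, Fintype.card_fin, ← hQ, nsmul_eq_mul]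
    calc _ = 2 * ((Q : ℝ≥0∞) * P E) := by ring
      _ ≤ 2 * (2 * ∑ f, P (H f)) := by gcongr
      _ = _ := by ring
  obtain ⟨f, -, hf⟩ := ENNReal.exists_le_of_sum_le Finset.univ_nonempty h3
  exact ⟨A f, hA f, hf⟩

noncomputable def cell (m : ℕ) (x : Set.Icc (0 : ℝ) 1) : Fin (m+1) :=
  ⟨⌊(x : ℝ) * m⌋₊, by
    have := x.2.2
    refine Nat.lt_succ_of_le (Nat.floor_le_of_le ?_)
    have : (0:ℝ) ≤ m := by positivity
    nlinarith⟩

lemma meas_cell (m : ℕ) : Measurable (cell m) := by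
  refine measurable_to_countable' fun i => ?_
  have : cell m ⁻¹' {i} = {x : Set.Icc (0 : ℝ) 1 | ⌊(x : ℝ) * m⌋₊ = i.1} := by
    ext x; simp [cell, Fin.ext_iff]
  rw [this]
  have h : Measurable fun x : Set.Icc (0 : ℝ) 1 => ⌊(x : ℝ) * m⌋₊ :=
    Nat.measurable_floor.comp (measurable_subtype_coe.mul_const _)
  exact h (measurableSet_singleton i.1)

lemma sep_two (x y : Set.Icc (0 : ℝ) 1) (h : x ≠ y) : ∀ᶠ m in atTop, cell m x ≠ cell m y := by
  have h0 : 0 < |(x : ℝ) - y| := by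
    rw [abs_pos, sub_ne_zero]; exact fun h' => h (Subtype.ext h')
  obtain ⟨k, hk⟩ := exists_nat_gt (1 / |(x : ℝ) - y|)
  filter_upwards [eventually_ge_atTop k] with m hm heq
  have hm' : (k : ℝ) ≤ m := by exact_mod_cast hm
  have h1 : 1 < |(x : ℝ) - y| * m := by
    rw [div_lt_iff₀ h0] at hk
    nlinarith
  have h2 : ⌊(x : ℝ) * m⌋₊ = ⌊(y : ℝ) * m⌋₊ := by simpa [cell] using heq
  have hx := x.2.1
  have hy := y.2.1
  have a1 := Nat.floor_le (a := (x : ℝ) * m) (by positivity)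
  have a2 := Nat.lt_floor_add_one ((x : ℝ) * m)
  have a3 := Nat.floor_le (a := (y : ℝ) * m) (by positivity)
  have a4 := Nat.lt_floor_add_one ((y : ℝ) * m)
  rw [h2] at a1 a2
  rcases abs_cases ((x : ℝ) - y) with ⟨h, _⟩ | ⟨h, _⟩ <;> rw [h] at h1 <;> nlinarith

lemma sep (F : Finset (Set.Icc (0 : ℝ) 1)) : ∀ᶠ m in atTop, Set.InjOn (cell m) F := by
  have : ∀ᶠ m in atTop, ∀ x ∈ F, ∀ y ∈ F, x ≠ y → cell m x ≠ cell m y := by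
    rw [Filter.eventually_all_finset]
    intro x _
    rw [Filter.eventually_all_finset]
    intro y _
    by_cases h : x = y
    · simp [h]
    · filter_upwards [sep_two x y h] with m hm _ using hm
  filter_upwards [this] with m hm x hx y hy hxy
  by_contra hne
  exact hm x hx y hy hne hxy

lemma ex_set {Ω : Type*} [MeasurableSpace Ω]
    (P : Measure Ω) [IsProbabilityMeasure P] (μ : Measure (Set.Icc (0 : ℝ) 1)) [IsProbabilityMeasure μ]
    (X : ℕ → Ω → Set.Icc (0 : ℝ) 1) (hX : ∀ t, Measurable (X t)) (c : ℝ≥0∞)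
    (hc : c < P {ω | (Set.range fun t => X t ω).Infinite}) (M : ℕ) :
    ∃ A : Set (Set.Icc (0 : ℝ) 1), MeasurableSet A ∧
      c + c * ((M + 1 : ℕ) : ℝ≥0∞) * μ A ≤ 4 * P {ω | ∃ t, X t ω ∈ A} := by
  obtain ⟨n, hn⟩ := ex_n M
  let E : ℕ → Set Ω := fun m => {ω | ∀ m' ≥ m, ∃ W : Finset (Fin (m'+1)), n ≤ W.card ∧ ∀ i ∈ W, ∃ t, cell m' (X t ω) = i}
  have hmono : Monotone E := fun a b hab ω h m' hm' => h m' (hab.trans hm')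
  have hsub : {ω | (Set.range fun t => X t ω).Infinite} ⊆ ⋃ m, E m := by
    intro ω hω
    obtain ⟨F, hF, hFn⟩ := Set.Infinite.exists_subset_card_eq hω n
    obtain ⟨m, hm⟩ := eventually_atTop.1 (sep F)
    refine Set.mem_iUnion.2 ⟨m, fun m' hm' => ⟨F.image (cell m'), ?_, ?_⟩⟩
    · rw [Finset.card_image_of_injOn (hm m' hm'), hFn]
    · intro i hi
      obtain ⟨x, hx, rfl⟩ := Finset.mem_image.1 hi
      obtain ⟨t, rfl⟩ := hF hx
      exact ⟨t, rfl⟩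
  have h := lt_of_lt_of_le hc (measure_mono hsub)
  rw [hmono.measure_iUnion] at h
  obtain ⟨m, hm⟩ := lt_iSup_iff.1 h
  obtain ⟨A, hA, hA2⟩ := sel P μ X hX (cell m) (meas_cell m) M n hn (E m) (fun ω hω => hω m le_rfl)
  refine ⟨A, hA, le_trans ?_ hA2⟩
  gcongr

lemma fmv_cont {𝒳 Ω : Type*} [MeasurableSpace 𝒳] [MeasurableSpace Ω]
    (P : Measure Ω) [IsProbabilityMeasure P] (X : ℕ → Ω → 𝒳) (hX : ∀ t, Measurable (X t))
    (hF : FMV P X) (A : ℕ → Set 𝒳) (hA : ∀ k, MeasurableSet (A k)) 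
    (hB : ∀ t, ∀ᵐ ω ∂P, X t ω ∉ limsup A atTop) (c : ℝ≥0∞) (hc : c ≠ 0)
    (hcA : ∀ k, c ≤ P {ω | ∃ t, X t ω ∈ A k}) : False := by
  classical
  let p : 𝒳 → ℕ → Prop := fun x k => (∀ j ≥ k, x ∉ A j) ∨ x ∈ limsup A atTop
  have hlim : ∀ x, x ∈ limsup A atTop ↔ ∀ k, ∃ j ≥ k, x ∈ A j := by
    intro x
    rw [mem_limsup_iff_frequently_mem, frequently_atTop]
  have hp : ∀ x, ∃ k, p x k := by
    intro x
    by_cases h : x ∈ limsup A atTop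
    · exact ⟨0, Or.inr h⟩
    · have h' := h
      rw [hlim] at h'
      push Not at h'
      obtain ⟨k, hk⟩ := h'
      exact ⟨k, Or.inl hk⟩
  have hm : ∀ k, MeasurableSet {x | p x k} := by
    intro k
    have : {x | p x k} = (⋂ j, ⋂ (_ : j ≥ k), (A j)ᶜ) ∪ limsup A atTop := by
      ext x; simp [p]
    rw [this]
    exact (MeasurableSet.iInter fun j => MeasurableSet.iInter fun _ => (hA j).compl).union
      (MeasurableSet.measurableSet_limsup hA)
  have hf := measurable_find hp hm
  set f : 𝒳 → ℕ := fun x => Nat.find (hp x) with hfdef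
  have hfin := hF (fun k => f ⁻¹' {k}) (fun k => hf (measurableSet_singleton k))
    (fun i j hij => Set.disjoint_left.2 fun x hx hy => hij (by
      simp only [Set.mem_preimage, Set.mem_singleton_iff] at hx hy
      rw [← hx, ← hy]))
    (by ext x; simp)
  let G : ℕ → Set Ω := fun k => {ω | ∀ t, ∀ j ≥ k, X t ω ∉ A j}
  have hG : Monotone G := fun a b hab ω h t j hj => h t j (hab.trans hj)
  have hGall : ∀ᵐ ω ∂P, ω ∈ ⋃ k, G k := by
    filter_upwards [hfin, ae_all_iff.2 hB] with ω h1 h2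
    obtain ⟨K, hK⟩ := h1.bddAbove
    refine Set.mem_iUnion.2 ⟨K, fun t j hj => ?_⟩
    have h3 : f (X t ω) ≤ K := hK ⟨t, rfl⟩
    rcases Nat.find_spec (hp (X t ω)) with h4 | h4
    · exact h4 j (h3.trans hj)
    · exact absurd h4 (h2 t)
  have h1 : P (⋃ k, G k) = 1 := by
    have : (⋃ k, G k) =ᵐ[P] (Set.univ : Set Ω) := eventuallyEq_univ.2 hGall
    rw [measure_congr this]
    exact measure_univ
  rw [hG.measure_iUnion] at h1
  have h2 : ∀ k, P (G k) ≤ 1 - c := by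
    intro k
    have hmeas : MeasurableSet {ω | ∃ t, X t ω ∈ A k} := by
      have : {ω | ∃ t, X t ω ∈ A k} = ⋃ t, X t ⁻¹' (A k) := by ext; simp
      rw [this]
      exact MeasurableSet.iUnion fun t => hX t (hA k)
    calc P (G k) ≤ P ({ω | ∃ t, X t ω ∈ A k}ᶜ) := by
          apply measure_mono
          rintro ω h ⟨t, ht⟩
          exact h t k le_rfl ht
      _ = 1 - P {ω | ∃ t, X t ω ∈ A k} := prob_compl_eq_one_sub hmeas
      _ ≤ _ := tsub_le_tsub_left (hcA k) _
  have h3 : (1 : ℝ≥0∞) ≤ 1 - c := h1.symm.le.trans (iSup_le h2)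
  exact absurd h3 (not_le.2 (ENNReal.sub_lt_self (by simp) (by simp) hc))

lemma fmv_fs {Ω : Type*}
    [MeasurableSpace Ω] (P : Measure Ω) [IsProbabilityMeasure P]
    (X : ℕ → Ω → (Set.Icc (0 : ℝ) 1)) (hX : ∀ t, Measurable (X t)) (hF : FMV P X) : FS P X := by
  by_contra hcon
  have hpos : P {ω | (Set.range fun t => X t ω).Infinite} ≠ 0 := fun h => hcon h
  obtain ⟨c, hc0, hc⟩ := exists_between (pos_iff_ne_zero.2 hpos)
  have hctop : c ≠ ∞ := ne_top_of_lt hc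
  let μ : Measure (Set.Icc (0 : ℝ) 1) := Measure.sum fun t => ((2 : ℝ≥0∞)⁻¹^(t+1)) • P.map (X t)
  have hμ : IsProbabilityMeasure μ := by
    constructor
    have : ∀ t, P.map (X t) Set.univ = 1 := fun t => by
      rw [Measure.map_apply (hX t) MeasurableSet.univ]; simp
    simp only [μ, Measure.sum_apply _ MeasurableSet.univ, Measure.smul_apply, this, smul_eq_mul, mul_one]
    rw [ENNReal.tsum_geometric_add_one, ENNReal.one_sub_inv_two, inv_inv]
    exact ENNReal.inv_mul_cancel (by simp) (by simp)
  have hex := fun k : ℕ => ex_set P μ X hX c hc (2^k)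
  choose A hA hA2 using hex
  have hν : ∀ k, c / 4 ≤ P {ω | ∃ t, X t ω ∈ A k} := by
    intro k
    rw [ENNReal.div_le_iff_le_mul (by simp) (by simp), mul_comm]
    exact le_trans le_self_add (hA2 k)
  have hμA : ∀ k, μ (A k) ≤ (4 / c) * (2 : ℝ≥0∞)⁻¹ ^ k := by
    intro k
    have h1 : c * (2^k * μ (A k)) ≤ 4 := by
      calc c * (2^k * μ (A k)) ≤ c * (((2^k + 1 : ℕ) : ℝ≥0∞) * μ (A k)) := by
            gcongr
            push_cast
            exact le_self_add
        _ ≤ 4 * P {ω | ∃ t, X t ω ∈ A k} := by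
            rw [← mul_assoc]; exact le_trans le_add_self (hA2 k)
        _ ≤ 4 * 1 := by gcongr; exact prob_le_one
        _ = 4 := mul_one _
    rw [mul_comm, ← ENNReal.le_div_iff_mul_le (Or.inl hc0.ne') (Or.inl hctop), mul_comm,
      ← ENNReal.le_div_iff_mul_le (by simp) (by simp)] at h1
    rwa [← ENNReal.inv_pow, ← div_eq_mul_inv]
  have hsum : ∑' k, μ (A k) ≠ ∞ := by
    refine ne_top_of_le_ne_top ?_ (ENNReal.tsum_le_tsum hμA)
    rw [ENNReal.tsum_mul_left, ENNReal.tsum_geometric]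
    refine ENNReal.mul_ne_top (ENNReal.div_ne_top (by simp) hc0.ne') ?_
    simp
  have h0 := measure_limsup_atTop_eq_zero hsum
  have hmB : MeasurableSet (limsup A atTop) := MeasurableSet.measurableSet_limsup hA
  refine fmv_cont P X hX hF A hA ?_ (c/4) (by simp [hc0.ne']) hν
  intro t
  simp only [μ] at h0
  rw [Measure.sum_apply_eq_zero] at h0
  have h1 := h0 t
  rw [Measure.smul_apply, Measure.map_apply (hX t) hmB, smul_eq_mul, mul_eq_zero] at h1
  rcases h1 with h1 | h1
  · simp at h1
  · rw [ae_iff]; simp only [not_not]; exact h1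

lemma fs_fmv {𝒳 Ω : Type*} [MeasurableSpace 𝒳] [MeasurableSpace Ω]
    (P : Measure Ω) (X : ℕ → Ω → 𝒳) (h : FS P X) : FMV P X := by
  intro A _ hd hu
  filter_upwards [h] with ω hω
  have hex : ∀ x, ∃ k, x ∈ A k := fun x => Set.mem_iUnion.1 (hu ▸ Set.mem_univ x)
  choose g hg using hex
  refine (hω.image g).subset ?_
  rintro k ⟨t, ht⟩
  refine ⟨X t ω, ⟨t, rfl⟩, ?_⟩
  by_contra hne
  exact Set.disjoint_left.1 (hd hne) (hg _) ht

/-- **Theorem (FMV = FS on `[0,1]`).** For `𝒳 = [0,1]` with its usual metric and Borel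
σ-algebra, a stochastic process `X` on `[0,1]` visits only finitely many cells of every
countable measurable partition almost surely iff it almost surely takes only finitely many
distinct values. -/
theorem fmv_eq_fs_unit_interval {Ω : Type*}
    [MeasurableSpace Ω] (P : Measure Ω) [IsProbabilityMeasure P]
    (X : ℕ → Ω → (Set.Icc (0 : ℝ) 1)) (hX : ∀ t, Measurable (X t)) :
    FMV P X ↔ FS P X := by
  exact ⟨fmv_fs P X hX, fs_fmv P X⟩
end

section
/- Let 𝒳 be a separable metric space and 𝕏 a stochastic process on 𝒳 satisfying condition FMV. Then for any δ, ε > 0 and any m₀ ∈ ℕ, there exist M ≥ m₀ and Borel sets G_1,…,G_M ⊂ 𝒳 that are pairwise disjoint, each of diameter sup_{x,x' ∈ G_i} ρ(x,x') ≤ δ, and such that the probability that some X_t falls outside ∪_{i=1}^M G_i is strictly less than ε. -/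
open MeasureTheory Filter

/-- **Lemma (effective total boundedness under FMV).** Let `𝒳` be a separable metric space and
`X` a stochastic process on `𝒳` satisfying condition FMV. Then for any `δ, ε > 0` and any
`m₀ ∈ ℕ`, there exist `M ≥ m₀` and pairwise disjoint Borel sets `G 1, …, G M` of diameter at
most `δ` such that the probability that some `X t` falls outside `⋃ i, G i` is strictly less
than `ε`. -/
theorem fmv_effectively_totally_bounded {𝒳 Ω : Type*}
    [MetricSpace 𝒳] [TopologicalSpace.SeparableSpace 𝒳]
    [MeasurableSpace 𝒳] [BorelSpace 𝒳]
    [MeasurableSpace Ω] (P : Measure Ω) [IsProbabilityMeasure P]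
    (X : ℕ → Ω → 𝒳) (hX : ∀ t, Measurable (X t)) (hFMV : FMV P X)
    (δ ε : ℝ) (hδ : 0 < δ) (hε : 0 < ε) (m₀ : ℕ) :
    ∃ M : ℕ, m₀ ≤ M ∧
      ∃ G : Fin M → Set 𝒳,
        (∀ i, MeasurableSet (G i)) ∧
        Pairwise (Function.onFun Disjoint G) ∧
        (∀ i, ∀ x ∈ G i, ∀ x' ∈ G i, dist x x' ≤ δ) ∧
        P {ω | ∃ t, X t ω ∉ ⋃ i, G i} < ENNReal.ofReal ε := by
  obtain ⟨ω₀⟩ : Nonempty Ω := nonempty_of_isProbabilityMeasure P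
  have : Nonempty 𝒳 := ⟨X 0 ω₀⟩
  set A : ℕ → Set 𝒳 :=
    disjointed (fun n => Metric.ball (TopologicalSpace.denseSeq 𝒳 n) (δ / 2)) with hA
  have hAm : ∀ k, MeasurableSet (A k) :=
    fun k => MeasurableSet.disjointed (fun n => measurableSet_ball) k
  have hAd : Pairwise (Function.onFun Disjoint A) := disjoint_disjointed _
  have hAu : (⋃ k, A k) = Set.univ := by
    rw [hA, iUnion_disjointed, Set.eq_univ_iff_forall]
    intro x
    obtain ⟨n, hn⟩ := (TopologicalSpace.denseRange_denseSeq 𝒳).exists_dist_lt x (half_pos hδ)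
    exact Set.mem_iUnion.2 ⟨n, hn⟩
  have hfin := hFMV A hAm hAd hAu
  let B : ℕ → Set Ω := fun n => {ω | ∃ t, X t ω ∉ ⋃ i : Fin n, A i}
  have hBm : ∀ n, MeasurableSet (B n) := by
    intro n
    have : B n = ⋃ t, (X t) ⁻¹' (⋃ i : Fin n, A i)ᶜ := by
      ext ω; simp [B]
    rw [this]
    exact MeasurableSet.iUnion fun t =>
      hX t (MeasurableSet.iUnion fun i : Fin n => hAm i).compl
  have hBa : Antitone B := by
    rintro m n hmn ω ⟨t, ht⟩
    refine ⟨t, fun h => ht ?_⟩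
    obtain ⟨i, hi⟩ := Set.mem_iUnion.1 h
    exact Set.mem_iUnion.2 ⟨⟨i, i.2.trans_le hmn⟩, hi⟩
  have hB0 : P (⋂ n, B n) = 0 := by
    refine measure_mono_null ?_ (ae_iff.1 hfin)
    intro ω hω hf
    obtain ⟨N, hN⟩ := hf.bddAbove
    obtain ⟨t, ht⟩ := Set.mem_iInter.1 hω (N + 1)
    obtain ⟨k, hk⟩ := Set.mem_iUnion.1 (hAu ▸ Set.mem_univ (X t ω) : X t ω ∈ ⋃ k, A k)
    exact ht (Set.mem_iUnion.2 ⟨⟨k, Nat.lt_succ_of_le (hN ⟨t, hk⟩)⟩, hk⟩)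
  have hlim := tendsto_measure_iInter_atTop (μ := P)
    (fun n => (hBm n).nullMeasurableSet) hBa ⟨0, measure_ne_top P _⟩
  rw [hB0] at hlim
  obtain ⟨M, hM, hm⟩ := ((hlim.eventually (gt_mem_nhds (ENNReal.ofReal_pos.2 hε))).and
    (eventually_ge_atTop m₀)).exists
  refine ⟨M, hm, fun i => A i, fun i => hAm i, ?_, ?_, hM⟩
  · intro i j hij
    exact hAd (fun h => hij (Fin.ext h))
  · intro i x hx y hy
    have h1 := Metric.mem_ball.1 (disjointed_subset (fun n => Metric.ball (TopologicalSpace.denseSeq 𝒳 n) (δ / 2)) i hx)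
    have h2 := Metric.mem_ball.1 (disjointed_subset (fun n => Metric.ball (TopologicalSpace.denseSeq 𝒳 n) (δ / 2)) i hy)
    have h3 := dist_triangle_right x y (TopologicalSpace.denseSeq 𝒳 i)
    linarith
end

section
/- Let 𝒳 be a standard Borel space. Then FMV = FS: a stochastic process 𝕏 on 𝒳 satisfies the condition that for every countable measurable partition of 𝒳 it almost surely visits only finitely many cells, if and only if 𝕏 almost surely takes only finitely many distinct values. -/
open MeasureTheory Filter

/-- Counting functions that avoid `0` on a finite set. -/
theorem fmvaux_card_avoid {C : Type*} [Fintype C] [DecidableEq C] (M : ℕ) (F : Finset C) :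
    ((Finset.univ.filter fun h : C → Fin (M+1) => ∀ c ∈ F, h c ≠ 0).card : ℝ)
      = (1 - 1 / ((M:ℝ)+1)) ^ F.card * Fintype.card (C → Fin (M+1)) := by
  have h1 : (Finset.univ.filter fun h : C → Fin (M+1) => ∀ c ∈ F, h c ≠ 0)
      = Fintype.piFinset (fun c => if c ∈ F then Finset.univ.erase (0 : Fin (M+1)) else Finset.univ) := by
    ext h
    simp only [Finset.mem_filter, Finset.mem_univ, true_and, Fintype.mem_piFinset]
    refine forall_congr' fun c => ?_
    by_cases hc : c ∈ F <;> simp [hc]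
  have hM : (M:ℝ) + 1 ≠ 0 := by positivity
  have h2 : ∀ c : C, (((if c ∈ F then Finset.univ.erase (0 : Fin (M+1)) else Finset.univ).card : ℕ) : ℝ)
      = (if c ∈ F then (1 - 1 / ((M:ℝ)+1)) else 1) * ((M:ℝ)+1) := by
    intro c
    by_cases hc : c ∈ F
    · simp [hc]; field_simp; ring
    · simp [hc]
  rw [h1, Fintype.card_piFinset, Nat.cast_prod, Finset.prod_congr rfl (fun c _ => h2 c),
    Finset.prod_mul_distrib, Finset.prod_ite_mem]
  simp

theorem fmvaux_card_zero {C : Type*} [Fintype C] [DecidableEq C] (M : ℕ) (c : C) :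
    ((Finset.univ.filter fun h : C → Fin (M+1) => h c = 0).card : ℝ)
      = (1 / ((M:ℝ)+1)) * Fintype.card (C → Fin (M+1)) := by
  have h1 := fmvaux_card_avoid M ({c} : Finset C)
  have h2 := Finset.card_filter_add_card_filter_not (s := (Finset.univ : Finset (C → Fin (M+1))))
    (fun h => h c = 0)
  have h3 : ((Finset.univ.filter fun h : C → Fin (M+1) => h c = 0).card : ℝ) +
    ((Finset.univ.filter fun h : C → Fin (M+1) => ¬ h c = 0).card : ℝ)
      = Fintype.card (C → Fin (M+1)) := by exact_mod_cast h2
  simp only [Finset.mem_singleton, forall_eq, Finset.card_singleton, pow_one] at h1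
  simp only [ne_eq] at h1
  rw [h1] at h3
  linarith

/-- Averaging over random hash functions. -/
theorem fmvaux_average {Ω C : Type*} [MeasurableSpace Ω] (P : Measure Ω) [IsProbabilityMeasure P]
    [Fintype C] [DecidableEq C] [MeasurableSpace C] [DiscreteMeasurableSpace C]
    (Y : ℕ → Ω → C) (hY : ∀ t, Measurable (Y t)) (S n N M : ℕ) :
    ∃ D : Set C, P.real {ω | ∃ t < S, Y t ω ∈ D} +
      P.real {ω | N ≤ ((Finset.range n).image fun t => Y t ω).card ∧ ∀ t < n, Y t ω ∉ D}
      ≤ S * (1 / ((M:ℝ)+1)) + (1 - 1 / ((M:ℝ)+1)) ^ N := by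
  classical
  set δ : ℝ := S * (1 / ((M:ℝ)+1)) + (1 - 1 / ((M:ℝ)+1)) ^ N with hδ
  let H := C → Fin (M+1)
  let U : H → Set Ω := fun h => {ω | ∃ t < S, h (Y t ω) = 0}
  let V : H → Set Ω := fun h =>
    {ω | N ≤ ((Finset.range n).image fun t => Y t ω).card ∧ ∀ t < n, h (Y t ω) ≠ 0}
  have hU : ∀ h, MeasurableSet (U h) := by
    intro h
    have : U h = ⋃ t, ⋃ (_ : t < S), Y t ⁻¹' {c | h c = 0} := by ext; simp [U]
    rw [this]
    exact MeasurableSet.iUnion fun t => MeasurableSet.iUnion fun _ =>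
      hY t (MeasurableSet.of_discrete)
  have hV : ∀ h, MeasurableSet (V h) := by
    intro h
    let Z : Ω → (Fin n → C) := fun ω i => Y i ω
    have hZ : Measurable Z := measurable_pi_lambda _ fun i => hY i
    have : V h = Z ⁻¹' {z | N ≤ (Finset.univ.image z).card ∧ ∀ i, h (z i) ≠ 0} := by
      ext ω
      have : ((Finset.range n).image fun t => Y t ω) = Finset.univ.image (Z ω) := by
        ext c
        simp only [Finset.mem_image, Finset.mem_range, Finset.mem_univ, true_and, Z]
        exact ⟨fun ⟨a, ha, hb⟩ => ⟨⟨a, ha⟩, hb⟩, fun ⟨a, ha⟩ => ⟨a, a.2, ha⟩⟩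
      simp only [V, Set.mem_ofPred_eq, Set.mem_preimage, this]
      refine and_congr_right fun _ => ?_
      exact ⟨fun hh i => hh i i.2, fun hh t ht => hh ⟨t, ht⟩⟩
    rw [this]
    exact hZ (Set.toFinite _).measurableSet
  have hpt : ∀ ω, ∑ h : H, ((U h).indicator (fun _ => (1:ℝ)) ω + (V h).indicator (fun _ => (1:ℝ)) ω)
      ≤ Fintype.card H * δ := by
    intro ω
    rw [Finset.sum_add_distrib]
    have hb : (0:ℝ) ≤ 1 - 1 / ((M:ℝ)+1) := by
      rw [sub_nonneg, div_le_one (by positivity)]; linarith [(Nat.cast_nonneg M : (0:ℝ) ≤ M)]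
    have hb1 : 1 - 1 / ((M:ℝ)+1) ≤ 1 := by
      have : (0:ℝ) ≤ 1 / ((M:ℝ)+1) := by positivity
      linarith
    have e1 : ∑ h : H, (U h).indicator (fun _ => (1:ℝ)) ω
        ≤ S * (1 / ((M:ℝ)+1)) * Fintype.card H := by
      calc ∑ h : H, (U h).indicator (fun _ => (1:ℝ)) ω
          ≤ ∑ h : H, ∑ t ∈ Finset.range S, (if h (Y t ω) = 0 then (1:ℝ) else 0) := by
            refine Finset.sum_le_sum fun h _ => ?_
            have hnn : ∀ t ∈ Finset.range S, (0:ℝ) ≤ (if h (Y t ω) = 0 then (1:ℝ) else 0) := by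
              intro t _; split_ifs <;> norm_num
            by_cases hω : ω ∈ U h
            · rw [Set.indicator_of_mem hω]
              obtain ⟨t, ht, h0⟩ := hω
              have := Finset.single_le_sum hnn (Finset.mem_range.2 ht)
              simpa [h0] using this
            · rw [Set.indicator_of_notMem hω]
              exact Finset.sum_nonneg hnn
        _ = ∑ t ∈ Finset.range S, (1 / ((M:ℝ)+1)) * Fintype.card H := by
            rw [Finset.sum_comm]
            refine Finset.sum_congr rfl fun t _ => ?_
            rw [← fmvaux_card_zero M (Y t ω), Finset.sum_boole]
        _ = _ := by simp; ring
    have e2 : ∑ h : H, (V h).indicator (fun _ => (1:ℝ)) ω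
        ≤ (1 - 1 / ((M:ℝ)+1)) ^ N * Fintype.card H := by
      by_cases hN : N ≤ ((Finset.range n).image fun t => Y t ω).card
      · have : ∑ h : H, (V h).indicator (fun _ => (1:ℝ)) ω = ∑ h : H,
            (if ∀ c ∈ (Finset.range n).image (fun t => Y t ω), h c ≠ 0 then (1:ℝ) else 0) := by
          refine Finset.sum_congr rfl fun h _ => ?_
          rw [Set.indicator_apply]
          congr 1
          simp [V, hN]
        rw [this, Finset.sum_boole, fmvaux_card_avoid]
        gcongr ?_ * _
        exact pow_le_pow_of_le_one hb hb1 hN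
      · have : ∑ h : H, (V h).indicator (fun _ => (1:ℝ)) ω = 0 :=
          Finset.sum_eq_zero fun h _ => Set.indicator_of_notMem (fun hh => hN hh.1) _
        rw [this]; positivity
    rw [hδ]; linarith
  have hint : ∑ h : H, (P.real (U h) + P.real (V h)) ≤ ∑ _h : H, δ := by
    have iU : ∀ h, Integrable ((U h).indicator (fun _ => (1:ℝ))) P := fun h =>
      (integrable_const 1).indicator (hU h)
    have iV : ∀ h, Integrable ((V h).indicator (fun _ => (1:ℝ))) P := fun h =>
      (integrable_const 1).indicator (hV h)
    have e : ∑ h : H, (P.real (U h) + P.real (V h)) = ∫ ω, ∑ h : H,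
        ((U h).indicator (fun _ => (1:ℝ)) ω + (V h).indicator (fun _ => (1:ℝ)) ω) ∂P := by
      refine Eq.trans ?_ (integral_finsetSum (μ := P) Finset.univ (f := fun (h : H) ω =>
        (U h).indicator (fun _ => (1:ℝ)) ω + (V h).indicator (fun _ => (1:ℝ)) ω)
        (fun h _ => (iU h).add (iV h))).symm
      refine Finset.sum_congr rfl fun h _ => ?_
      rw [integral_add (iU h) (iV h), integral_indicator_const _ (hU h),
        integral_indicator_const _ (hV h)]
      simp
    rw [e]
    calc _ ≤ ∫ _ω, (Fintype.card H * δ) ∂P :=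
          integral_mono (integrable_finsetSum _ fun h _ => (iU h).add (iV h))
            (integrable_const _) hpt
      _ = _ := by simp
  obtain ⟨h, -, hh⟩ := Finset.exists_le_of_sum_le Finset.univ_nonempty hint
  exact ⟨{c | h c = 0}, hh⟩

theorem fmvaux_step {𝒳 Ω : Type*}
    [MeasurableSpace 𝒳] [StandardBorelSpace 𝒳]
    [MeasurableSpace Ω] (P : Measure Ω) [IsProbabilityMeasure P]
    (X : ℕ → Ω → 𝒳) (hX : ∀ t, Measurable (X t)) (S : ℕ) (ε : ℝ) (hε : 0 < ε) :
    ∃ (B : Set 𝒳) (T : ℕ), MeasurableSet B ∧ S ≤ T ∧ P.real {ω | ∃ t < S, X t ω ∈ B} ≤ ε ∧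
      P.real {ω | (Set.range fun t => X t ω).Infinite ∧ ∀ t < T, X t ω ∉ B} ≤ ε := by
  classical
  -- choose parameters
  obtain ⟨M, hM⟩ : ∃ M : ℕ, S * (1 / ((M:ℝ)+1)) < ε / 4 := by
    have := (tendsto_one_div_add_atTop_nhds_zero_nat (𝕜 := ℝ)).const_mul (S:ℝ)
    rw [mul_zero] at this
    exact (this.eventually_lt_const (by positivity)).exists
  obtain ⟨N, hN⟩ : ∃ N : ℕ, (1 - 1 / ((M:ℝ)+1)) ^ N < ε / 4 := by
    refine exists_pow_lt_of_lt_one (by positivity) ?_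
    have : (0:ℝ) < 1 / ((M:ℝ)+1) := by positivity
    linarith
  let g : (n : ℕ) → 𝒳 → (Fin n → Bool) := fun n x i => MeasurableSpace.mapNatBool 𝒳 x i
  have hg : ∀ n, Measurable (g n) := fun n => measurable_pi_lambda _ fun i =>
    (measurable_pi_apply (i : ℕ)).comp (MeasurableSpace.measurable_mapNatBool 𝒳)
  have hgle : ∀ {m n : ℕ}, m ≤ n → ∀ x y, g n x = g n y → g m x = g m y := by
    intro m n hmn x y h
    funext i
    exact congrFun h ⟨i, i.2.trans_le hmn⟩
  let G : ℕ → Set Ω := fun n => {ω | N ≤ ((Finset.range n).image fun t => g n (X t ω)).card}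
  have hGmeas : ∀ n, MeasurableSet (G n) := by
    intro n
    let Z : Ω → (Fin n → (Fin n → Bool)) := fun ω i => g n (X i ω)
    have hZ : Measurable Z := measurable_pi_lambda _ fun i => (hg n).comp (hX i)
    have : G n = Z ⁻¹' {z | N ≤ (Finset.univ.image z).card} := by
      ext ω
      have : ((Finset.range n).image fun t => g n (X t ω)) = Finset.univ.image (Z ω) := by
        ext c
        simp only [Finset.mem_image, Finset.mem_range, Finset.mem_univ, true_and, Z]
        exact ⟨fun ⟨a, ha, hb⟩ => ⟨⟨a, ha⟩, hb⟩, fun ⟨a, ha⟩ => ⟨a, a.2, ha⟩⟩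
      simp only [G, Set.mem_ofPred_eq, Set.mem_preimage, this]
    rw [this]
    exact hZ (Set.toFinite _).measurableSet
  have hGmono : Monotone G := by
    intro m n hmn ω hω
    change N ≤ _ at hω
    change N ≤ _
    refine le_trans hω ?_
    let r : (Fin n → Bool) → (Fin m → Bool) := fun z i => z ⟨i, i.2.trans_le hmn⟩
    refine le_trans (Finset.card_le_card ?_)
      (Finset.card_image_le (s := (Finset.range n).image fun t => g n (X t ω)) (f := r))
    intro c hc
    simp only [Finset.mem_image, Finset.mem_range] at hc ⊢
    obtain ⟨t, ht, rfl⟩ := hc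
    exact ⟨_, ⟨t, ht.trans_le hmn, rfl⟩, rfl⟩
  have hEG : ∀ ω, (Set.range fun t => X t ω).Infinite → ω ∈ ⋃ n, G n := by
    intro ω hω
    obtain ⟨F, hF, hFc⟩ := hω.exists_subset_card_eq N
    have hF' : ∀ x : 𝒳, ∃ t, x ∈ F → X t ω = x := by
      intro x
      by_cases hx : x ∈ F
      · obtain ⟨t, ht⟩ := hF hx
        exact ⟨t, fun _ => ht⟩
      · exact ⟨0, fun h => absurd h hx⟩
    choose τ hτ using hF'
    have hsep : ∀ x y : 𝒳, ∃ n, x ≠ y → g n x ≠ g n y := by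
      intro x y
      by_cases hxy : x = y
      · exact ⟨0, fun h => absurd hxy h⟩
      have : MeasurableSpace.mapNatBool 𝒳 x ≠ MeasurableSpace.mapNatBool 𝒳 y :=
        fun h => hxy (MeasurableSpace.injective_mapNatBool 𝒳 h)
      obtain ⟨i, hi⟩ := Function.ne_iff.1 this
      exact ⟨i + 1, fun _ h => hi (congrFun h ⟨i, i.lt_succ_self⟩)⟩
    choose ν hν using hsep
    let n := max ((F.sup τ) + 1) ((F ×ˢ F).sup fun p => ν p.1 p.2)
    refine Set.mem_iUnion.2 ⟨n, ?_⟩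
    change N ≤ _
    rw [← hFc]
    refine Finset.card_le_card_of_injOn (g n) ?_ ?_
    · intro x hx
      have hx' : x ∈ F := hx
      simp only [Finset.coe_image, Set.mem_image, Finset.coe_range, Set.mem_Iio]
      refine ⟨τ x, ?_, ?_⟩
      · have := Finset.le_sup (f := τ) hx'
        have h2 : F.sup τ + 1 ≤ n := le_max_left _ _
        omega
      · rw [hτ x hx']
    · intro x hx y hy hxy
      by_contra hne
      have hp : (x, y) ∈ F ×ˢ F := Finset.mem_product.2 ⟨hx, hy⟩
      have := Finset.le_sup (f := fun p : 𝒳 × 𝒳 => ν p.1 p.2) hp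
      exact hν x y hne (hgle (this.trans (le_max_right _ _)) x y hxy)
  obtain ⟨n, hn⟩ : ∃ n, P.real ((⋃ n, G n) \ G n) < ε / 2 := by
    have h1 : Tendsto (fun n => P.real (G n)) atTop (nhds (P.real (⋃ n, G n))) :=
      (ENNReal.tendsto_toReal (measure_ne_top _ _)).comp (tendsto_measure_iUnion_atTop hGmono)
    obtain ⟨n, hn⟩ := (h1.eventually_const_lt
      (show P.real (⋃ n, G n) - ε / 2 < P.real (⋃ n, G n) by linarith)).exists
    refine ⟨n, ?_⟩
    rw [measureReal_sdiff (Set.subset_iUnion G n) (hGmeas n)]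
    linarith
  obtain ⟨D, hD⟩ := fmvaux_average P (fun t ω => g n (X t ω)) (fun t => (hg n).comp (hX t)) S n N M
  refine ⟨g n ⁻¹' D, max S n, hg n (Set.toFinite _).measurableSet, le_max_left _ _, ?_, ?_⟩
  · have := measureReal_nonneg (μ := P)
      (s := {ω | N ≤ ((Finset.range n).image fun t => g n (X t ω)).card ∧ ∀ t < n, g n (X t ω) ∉ D})
    change P.real {ω | ∃ t < S, g n (X t ω) ∈ D} ≤ ε
    linarith
  · have h0 := measureReal_nonneg (μ := P) (s := {ω | ∃ t < S, g n (X t ω) ∈ D})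
    have hsub : {ω | (Set.range fun t => X t ω).Infinite ∧ ∀ t < max S n, X t ω ∉ g n ⁻¹' D} ⊆
        ((⋃ n, G n) \ G n) ∪ {ω | N ≤ ((Finset.range n).image fun t => g n (X t ω)).card ∧
          ∀ t < n, g n (X t ω) ∉ D} := by
      rintro ω ⟨h1, h2⟩
      by_cases hω : ω ∈ G n
      · exact Or.inr ⟨hω, fun t ht => h2 t (lt_max_of_lt_right ht)⟩
      · exact Or.inl ⟨hEG ω h1, hω⟩
    have := (measureReal_mono (μ := P) hsub).trans (measureReal_union_le _ _)
    linarith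

/-- **Theorem (FMV = FS on standard Borel spaces).** For any standard Borel space `𝒳`, a
stochastic process `X` on `𝒳` visits only finitely many cells of every countable measurable
partition almost surely iff it almost surely takes only finitely many distinct values. -/
theorem fmv_eq_fs_standardBorel {𝒳 Ω : Type*}
    [MeasurableSpace 𝒳] [StandardBorelSpace 𝒳]
    [MeasurableSpace Ω] (P : Measure Ω) [IsProbabilityMeasure P]
    (X : ℕ → Ω → 𝒳) (hX : ∀ t, Measurable (X t)) :
    FMV P X ↔ FS P X := by
  constructor
  · intro hF
    choose! B T hB hST hP1 hP2 using
      fun (S k : ℕ) => fmvaux_step P X hX S ((1/2:ℝ)^k) (by positivity)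
    let τ : ℕ → ℕ := fun k => Nat.rec 0 (fun k s => T s k) k
    have hτ : ∀ k, τ (k+1) = T (τ k) k := fun k => rfl
    have hτm : Monotone τ := monotone_nat_of_le_succ fun k => hST (τ k) k
    let b : ℕ → Set 𝒳 := fun k => B (τ k) k
    have hb : ∀ k, MeasurableSet (b k) := fun k => hB _ _
    have hsum : ∑' k, ENNReal.ofReal ((1/2:ℝ)^k) ≠ ⊤ :=
      (summable_geometric_of_lt_one (by norm_num) (by norm_num)).tsum_ofReal_ne_top
    have bc : ∀ s : ℕ → Set Ω, (∀ k, P.real (s k) ≤ (1/2:ℝ)^k) →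
        ∀ᵐ ω ∂P, ∀ᶠ k in atTop, ω ∉ s k := by
      intro s hs
      refine ae_eventually_notMem (ne_top_of_le_ne_top hsum ?_)
      refine ENNReal.tsum_le_tsum fun k => ?_
      rw [← ofReal_measureReal]
      exact ENNReal.ofReal_le_ofReal (hs k)
    have ae1 := bc _ fun k => hP1 (τ k) k
    have ae2 := bc _ fun k => hP2 (τ k) k
    let a : ℕ → Set 𝒳 := fun k => b k \ ⋃ j, ⋃ (_ : k < j), b j
    have ha : ∀ k, MeasurableSet (a k) := fun k =>
      (hb k).diff (MeasurableSet.iUnion fun j => MeasurableSet.iUnion fun _ => hb j)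
    have hadlt : ∀ i j, i < j → Disjoint (a i) (a j) := by
      intro i j hij
      refine Set.disjoint_left.2 fun x hx hy => hx.2 ?_
      exact Set.mem_iUnion₂.2 ⟨j, hij, hy.1⟩
    let A : ℕ → Set 𝒳 := fun k => Nat.casesOn k (⋃ i, a i)ᶜ a
    have hA0 : A 0 = (⋃ i, a i)ᶜ := rfl
    have hAs : ∀ k, A (k+1) = a k := fun k => rfl
    have hd0 : ∀ k, Disjoint (A 0) (A (k+1)) := by
      intro k
      refine Set.disjoint_left.2 fun x hx hy => hx ?_
      exact Set.mem_iUnion.2 ⟨k, hy⟩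
    have ae3 := hF A
      (by
        rintro (_ | k)
        · exact (MeasurableSet.iUnion ha).compl
        · exact ha k)
      (by
        rintro (_ | i) (_ | j) hij
        · exact absurd rfl hij
        · exact hd0 j
        · exact (hd0 i).symm
        · have : i ≠ j := fun h => hij (by rw [h])
          rcases lt_or_gt_of_ne this with h | h
          · exact hadlt i j h
          · exact (hadlt j i h).symm)
      (by
        refine Set.eq_univ_of_forall fun x => ?_
        by_cases hx : x ∈ ⋃ i, a i
        · obtain ⟨i, hi⟩ := Set.mem_iUnion.1 hx
          exact Set.mem_iUnion.2 ⟨i+1, hi⟩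
        · exact Set.mem_iUnion.2 ⟨0, hx⟩)
    unfold FS
    filter_upwards [ae1, ae2, ae3] with ω h1 h2 h3
    by_contra hinf
    obtain ⟨K, hK⟩ := eventually_atTop.1 (h1.and h2)
    refine (Set.infinite_of_injective_forall_mem (f := fun k : ℕ => K + k + 1)
      (fun x y h => by simpa using h) (fun k => ?_)) h3
    have h4 := (hK (K+k) (by omega)).2
    simp only [Set.mem_ofPred_eq, not_and, not_forall, not_not] at h4
    obtain ⟨t, ht, hmem⟩ := h4 hinf
    refine ⟨t, hmem, fun hx => ?_⟩
    obtain ⟨j, hj, hxj⟩ := Set.mem_iUnion₂.1 hx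
    refine (hK j (by omega)).1 ⟨t, ?_, hxj⟩
    exact lt_of_lt_of_le ht (hτm (Nat.succ_le_of_lt hj))
  · intro h A _ hd _
    unfold FS at h
    filter_upwards [h] with ω hω
    have hsub : ∀ k ∈ {k : ℕ | ∃ t, X t ω ∈ A k}, ∃ x ∈ Set.range (fun t => X t ω), x ∈ A k := by
      rintro k ⟨t, ht⟩
      exact ⟨_, ⟨t, rfl⟩, ht⟩
    haveI : Nonempty 𝒳 := ⟨X 0 ω⟩
    choose! f hf hfA using hsub
    refine Set.Finite.of_finite_image (f := f) (hω.subset ?_) ?_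
    · rintro _ ⟨k, hk, rfl⟩
      exact hf k hk
    · intro i hi j hj hij
      by_contra hne
      have h1 := hfA i hi
      rw [hij] at h1
      exact Set.disjoint_left.1 (hd hne) h1 (hfA j hj)
end

section
/- FS ⊂ SUIL: if a stochastic process 𝕏 on a separable metric space 𝒳 almost surely takes only finitely many distinct values, then the memorization rule, used as an inductive learning rule, is strongly universally consistent: for every measurable target f* : 𝒳 → 𝒴, almost surely the inductive loss L_𝕏(f_t, f*; t) equals 0 for all sufficiently large t (in particular L_𝕏(f_t, f*; t) → 0 as t → ∞). -/
open MeasureTheory Filter Finset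

noncomputable section

/-- The inductive loss of the rule `f` trained on the first `t` data points of the process `X`
with target `fstar`: the `limsup` over `T` of the average loss over prediction times
`t, t+1, …, t+T`. -/
def inductiveLoss {𝒳 𝒴 Ω : Type*} (ℓ : 𝒴 → 𝒴 → ℝ)
    (f : (t : ℕ) → (Fin t → 𝒳) → (Fin t → 𝒴) → 𝒳 → 𝒴)
    (X : ℕ → Ω → 𝒳) (fstar : 𝒳 → 𝒴) (t : ℕ) (ω : Ω) : EReal :=
  Filter.limsup (fun T : ℕ =>
    (((∑ s ∈ Finset.range (T + 1),
        ℓ (f t (fun i : Fin t => X i ω) (fun i : Fin t => fstar (X i ω)) (X (t + s) ω))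
          (fstar (X (t + s) ω))) / (T : ℝ) : ℝ) : EReal)) atTop

/-- **Theorem (FS ⊆ SUIL).** If a stochastic process `X` on a separable metric space `𝒳`
almost surely takes only finitely many distinct values, then the memorization rule, used as an
inductive learning rule, is strongly universally consistent: for every measurable target
`fstar : 𝒳 → 𝒴`, almost surely the inductive loss is `0` for all sufficiently large training
horizons `t` (in particular it tends to `0` as `t → ∞`). -/
theorem fs_subset_suil {𝒳 𝒴 Ω : Type*}
    [MetricSpace 𝒳] [TopologicalSpace.SeparableSpace 𝒳]
    [MeasurableSpace 𝒳] [BorelSpace 𝒳] [MeasurableSpace 𝒴]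
    (ℓ : 𝒴 → 𝒴 → ℝ)
    (hℓmeas : Measurable fun p : 𝒴 × 𝒴 => ℓ p.1 p.2)
    (hℓnonneg : ∀ y y' : 𝒴, 0 ≤ ℓ y y')
    (hℓrefl : ∀ y : 𝒴, ℓ y y = 0)
    [MeasurableSpace Ω] (P : Measure Ω) [IsProbabilityMeasure P]
    (X : ℕ → Ω → 𝒳) (hX : ∀ t, Measurable (X t)) (y₀ : 𝒴)
    (hFS : FS P X) :
    ∀ fstar : 𝒳 → 𝒴, Measurable fstar →
      ∀ᵐ ω ∂P,
        (∀ᶠ t in atTop, inductiveLoss ℓ (memorizationRule y₀) X fstar t ω = 0) ∧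
        Tendsto (fun t => inductiveLoss ℓ (memorizationRule y₀) X fstar t ω)
          atTop (nhds (0 : EReal)) := by
  intro fstar _
  filter_upwards [hFS] with ω hω
  have key : ∀ᶠ t in atTop,
      inductiveLoss ℓ (memorizationRule y₀) X fstar t ω = 0 := by
    -- every value of the (finite) range is seen before some time `N`
    have hN : ∀ x ∈ Set.range (fun t => X t ω), ∀ᶠ t in atTop, ∃ s : Fin t, X s ω = x := by
      rintro x ⟨n, rfl⟩
      filter_upwards [eventually_gt_atTop n] with t ht
      exact ⟨⟨n, ht⟩, rfl⟩
    filter_upwards [(Filter.eventually_all_finite hω).2 hN] with t ht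
    have hz : ∀ s : ℕ, ℓ (memorizationRule y₀ t (fun i : Fin t => X i ω)
        (fun i : Fin t => fstar (X i ω)) (X (t + s) ω)) (fstar (X (t + s) ω)) = 0 := by
      intro s
      have h : ∃ i : Fin t, (fun i : Fin t => X i ω) i = X (t + s) ω := ht _ ⟨t + s, rfl⟩
      have hm : memorizationRule y₀ t (fun i : Fin t => X i ω)
          (fun i : Fin t => fstar (X i ω)) (X (t + s) ω) = fstar (X (t + s) ω) := by
        unfold memorizationRule
        rw [dif_pos h]
        exact congrArg fstar h.choose_spec
      rw [hm, hℓrefl]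
    unfold inductiveLoss
    simp only [hz, Finset.sum_const_zero, zero_div, EReal.coe_zero]
    exact Filter.limsup_const _
  exact ⟨key, tendsto_const_nhds.congr' (key.mono fun t ht => ht.symm)⟩

end
end

section
/- Let (𝒴, d) be a separable metric space in which every closed ball is compact, let p ≥ 1, and let Y be a 𝒴-valued random variable such that E[d(y₀, Y)^p] < ∞ for some y₀ ∈ 𝒴. Then the infimum inf_{y ∈ 𝒴} E[d(y, Y)^p] is attained, and it is attained within the closed ball around y₀ of radius 2·(E[d(y₀, Y)^p])^{1/p}. -/
open MeasureTheory

/-- **Lemma (existence and localization of Fréchet population means).** Let `(𝒴, d)` be a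
separable metric space in which every closed ball is compact, `p ≥ 1`, and `Y` a `𝒴`-valued
random variable with `E[d(y₀, Y)^p] < ∞` for some `y₀`. Then `inf_y E[d(y, Y)^p]` is attained,
and it is attained within the closed ball around `y₀` of radius `2 (E[d(y₀, Y)^p])^{1/p}`. -/
theorem frechet_population_mean_exists {𝒴 Ω : Type*}
    [MetricSpace 𝒴] [TopologicalSpace.SeparableSpace 𝒴] [ProperSpace 𝒴]
    [MeasurableSpace 𝒴] [BorelSpace 𝒴]
    [MeasurableSpace Ω] (P : Measure Ω) [IsProbabilityMeasure P]
    (p : ℝ) (hp : 1 ≤ p)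
    (Y : Ω → 𝒴) (hY : Measurable Y)
    (y₀ : 𝒴) (hmom : Integrable (fun ω => dist y₀ (Y ω) ^ p) P) :
    ∃ yhat : 𝒴,
      yhat ∈ Metric.closedBall y₀ (2 * (∫ ω, dist y₀ (Y ω) ^ p ∂P) ^ (1 / p)) ∧
      ∀ y : 𝒴, ∫ ω, dist yhat (Y ω) ^ p ∂P ≤ ∫ ω, dist y (Y ω) ^ p ∂P := by
  have hp0 : 0 < p := by linarith
  have key : ∀ a b c : 𝒴, dist a c ^ p ≤ 2 ^ (p - 1) * (dist a b ^ p + dist b c ^ p) := by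
    intro a b c
    exact (Real.rpow_le_rpow dist_nonneg (dist_triangle a b c) hp0.le).trans
      (by exact_mod_cast NNReal.rpow_add_le_mul_rpow_add_rpow (nndist a b) (nndist b c) hp)
  have hmeas : ∀ y : 𝒴, AEStronglyMeasurable (fun ω => dist y (Y ω) ^ p) P := by
    intro y
    have h : Continuous (fun z : 𝒴 => dist y z ^ p) :=
      (continuous_const.dist continuous_id).rpow_const (fun _ => Or.inr hp0.le)
    exact (h.measurable.comp hY).aestronglyMeasurable
  have hint : ∀ y : 𝒴, Integrable (fun ω => dist y (Y ω) ^ p) P := by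
    intro y
    refine Integrable.mono' (((integrable_const (dist y y₀ ^ p)).add hmom).const_mul
      (2 ^ (p - 1))) (hmeas y) (Filter.Eventually.of_forall fun ω => ?_)
    rw [Real.norm_of_nonneg (Real.rpow_nonneg dist_nonneg _)]
    exact key y y₀ (Y ω)
  set F : 𝒴 → ℝ := fun y => ∫ ω, dist y (Y ω) ^ p ∂P with hF
  have hF0 : 0 ≤ F y₀ := integral_nonneg fun ω => Real.rpow_nonneg dist_nonneg _
  set R : ℝ := 2 * (F y₀) ^ (1 / p) with hR
  have hR0 : 0 ≤ R := mul_nonneg (by norm_num) (Real.rpow_nonneg hF0 _)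
  have hcont : ContinuousOn F (Metric.closedBall y₀ R) := by
    refine continuousOn_of_dominated
      (bound := fun ω => 2 ^ (p - 1) * (R ^ p + dist y₀ (Y ω) ^ p)) (fun y _ => hmeas y) ?_
      (((integrable_const (R ^ p)).add hmom).const_mul (2 ^ (p - 1))) ?_
    · intro y hy
      refine Filter.Eventually.of_forall fun ω => ?_
      rw [Real.norm_of_nonneg (Real.rpow_nonneg dist_nonneg _)]
      refine (key y y₀ (Y ω)).trans ?_
      have := Real.rpow_le_rpow dist_nonneg (Metric.mem_closedBall.1 hy) hp0.le
      gcongr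
    · refine Filter.Eventually.of_forall fun ω => Continuous.continuousOn ?_
      exact (continuous_id.dist continuous_const).rpow_const (fun _ => Or.inr hp0.le)
  obtain ⟨z, hz, hmin⟩ := (isCompact_closedBall y₀ R).exists_isMinOn
    ⟨y₀, Metric.mem_closedBall_self hR0⟩ hcont
  refine ⟨z, hz, fun y => ?_⟩
  change F z ≤ F y
  by_cases hy : y ∈ Metric.closedBall y₀ R
  · exact hmin hy
  · refine (hmin (Metric.mem_closedBall_self hR0) : F z ≤ F y₀).trans ?_
    have hd : R < dist y y₀ := by simpa using hy
    have h1 : R ^ p ≤ dist y y₀ ^ p := Real.rpow_le_rpow hR0 hd.le hp0.le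
    have h2 : R ^ p = 2 ^ (p - 1) * (2 * F y₀) := by
      rw [hR, Real.mul_rpow (by norm_num) (Real.rpow_nonneg hF0 _), ← Real.rpow_mul hF0,
        one_div_mul_cancel hp0.ne', Real.rpow_one, Real.rpow_sub_one (by norm_num)]
      ring
    have h3 : dist y y₀ ^ p ≤ 2 ^ (p - 1) * (F y + F y₀) := by
      have h := integral_mono (μ := P) (integrable_const (dist y y₀ ^ p))
        (((hint y).add (hint y₀)).const_mul (2 ^ (p - 1)))
        (fun ω => by simpa [dist_comm y₀ (Y ω)] using key y (Y ω) y₀)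
      simp only [integral_const_mul, integral_const, Pi.add_apply] at h
      rw [integral_add (hint y) (hint y₀)] at h
      simpa using h
    have h4 : (2:ℝ) ^ (p - 1) * (2 * F y₀) ≤ 2 ^ (p - 1) * (F y + F y₀) := by linarith
    have h5 := le_of_mul_le_mul_left h4 (Real.rpow_pos_of_pos (by norm_num) _)
    linarith
end
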